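/- arXiv:1308.3143 — 3 statements merged into one kernel-verified Lean document; each statement's English description precedes it below -/
import Mathlib

section
/- Let K_1, …, K_p be dust-like graph-directed sets with ratio r ∈ (0,1) and adjacency matrix A, let m ≥ 2 be an integer, and set s = −log m / log r. Then there exists a vector v ∈ ℝ^p with all entries positive such that A v = m v if and only if 0 < 𝓗^s(K_i) < ∞ for every i = 1, …, p, where 𝓗^s denotes s-dimensional Hausdorff measure. -/
open MeasureTheory

open scoped Classical

/-- The symbolic space metric on `ℕ → Fin m`: `d(x,y) = r ^ (min {k | x k ≠ y k})`
for `x ≠ y`, and `d(x,x) = 0`. -/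
noncomputable def symbDist (r : ℝ) {m : ℕ} (x y : ℕ → Fin m) : ℝ :=
  if x = y then 0 else r ^ sInf {k : ℕ | x k ≠ y k}

/-- `K` (a subset of a metric space) is bilipschitz equivalent to the symbolic
space `Σ_m^r`. -/
def BilipWithSymb {X : Type*} [MetricSpace X] (K : Set X) (m : ℕ) (r : ℝ) : Prop :=
  ∃ f : K → (ℕ → Fin m), Function.Bijective f ∧ ∃ C : ℝ, 1 ≤ C ∧ ∀ x y : K,
    C⁻¹ * dist x y ≤ symbDist r (f x) (f y) ∧ symbDist r (f x) (f y) ≤ C * dist x y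

/-- `K ⊆ X` and `K' ⊆ X'` are bilipschitz equivalent (as metric spaces with the
induced metrics). -/
def BilipEquivSets {X Y : Type*} [MetricSpace X] [MetricSpace Y]
    (K : Set X) (K' : Set Y) : Prop :=
  ∃ f : K → K', Function.Bijective f ∧ ∃ C : ℝ, 1 ≤ C ∧ ∀ x y : K,
    C⁻¹ * dist x y ≤ dist (f x) (f y) ∧ dist (f x) (f y) ≤ C * dist x y

/-- Dust-like graph-directed sets with ratio `r` on a directed graph with `p`
vertices, where `a i j` is the number of edges from `i` to `j`:
nonempty compact sets `K i` with `K i = ⋃_j ⋃_{e : Fin (a i j)} S i j e '' (K j)`,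
the union being pairwise disjoint, each `S i j e` a similitude of ratio `r`. -/
structure GraphDirected (X : Type*) [MetricSpace X] (p : ℕ) (r : ℝ) where
  a : Fin p → Fin p → ℕ
  S : ∀ i j : Fin p, Fin (a i j) → X → X
  sim : ∀ i j e x y, dist (S i j e x) (S i j e y) = r * dist x y
  K : Fin p → Set X
  nonempty : ∀ i, (K i).Nonempty
  compact : ∀ i, IsCompact (K i)
  union : ∀ i, K i = ⋃ j, ⋃ e, S i j e '' K j
  disj : ∀ i : Fin p, ∀ j j' : Fin p, ∀ e : Fin (a i j), ∀ e' : Fin (a i j'),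
    (⟨j, e⟩ : Σ j, Fin (a i j)) ≠ ⟨j', e'⟩ →
    Disjoint (S i j e '' K j) (S i j' e' '' K j')

/-- The family has integer characteristic `m`: there is a positive vector `v`
with `A v = m v`, `A` being the adjacency matrix. -/
def GraphDirected.HasCharacteristic {X : Type*} [MetricSpace X] {p : ℕ} {r : ℝ}
    (G : GraphDirected X p r) (m : ℕ) : Prop :=
  ∃ v : Fin p → ℝ, (∀ i, 0 < v i) ∧ ∀ i, ∑ j, (G.a i j : ℝ) * v j = (m : ℝ) * v i

/-- `K` belongs to the class `𝔄_m^r`: `K = K_1` for some dust-like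
graph-directed sets `{K_1, …, K_p}` with ratio `r` and integer characteristic `m`. -/
def MemGDClass {X : Type*} [MetricSpace X] (K : Set X) (r : ℝ) (m : ℕ) : Prop :=
  ∃ (p : ℕ) (hp : 0 < p) (G : GraphDirected X p r),
    G.HasCharacteristic m ∧ K = G.K ⟨0, hp⟩

open Set Filter Topology
open scoped NNReal ENNReal

lemma exists_tiling {E : Type*} (s : Finset E) (w : E → ℝ) (hw : ∀ e, 0 ≤ w e) :
    ∃ b : E → ℝ, (∀ e, 0 ≤ b e ∧ b e ≤ ∑ e ∈ s, w e) ∧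
      ∀ t, 0 ≤ t → t < ∑ e ∈ s, w e → ∃ e ∈ s, b e ≤ t ∧ t < b e + w e := by
  classical
  induction s using Finset.induction_on with
  | empty =>
    refine ⟨fun _ => 0, by simp, ?_⟩
    intro t h0 h1
    simp at h1
    linarith
  | insert a s ha ih =>
    obtain ⟨b, hb, ht⟩ := ih
    have hs : 0 ≤ ∑ e ∈ s, w e := Finset.sum_nonneg fun e _ => hw e
    have hwa := hw a
    refine ⟨Function.update b a (∑ e ∈ s, w e), ?_, ?_⟩
    · intro e
      rw [Finset.sum_insert ha]
      by_cases h : e = a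
      · subst h
        rw [Function.update_self]
        exact ⟨hs, by linarith⟩
      · rw [Function.update_of_ne h]
        exact ⟨(hb e).1, by linarith [(hb e).2]⟩
    · intro t h0 h1
      rw [Finset.sum_insert ha] at h1
      by_cases h : t < ∑ e ∈ s, w e
      · obtain ⟨e, he, h2⟩ := ht t h0 h
        refine ⟨e, Finset.mem_insert_of_mem he, ?_⟩
        rw [Function.update_of_ne (by rintro rfl; exact ha he)]
        exact h2
      · refine ⟨a, Finset.mem_insert_self _ _, ?_⟩
        rw [Function.update_self]
        constructor <;> linarith

lemma exists_lower {T : Type*} [Finite T] (f : T → ℝ) (hf : ∀ t, 0 < f t) :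
    ∃ δ : ℝ, 0 < δ ∧ ∀ t, δ ≤ f t := by
  cases isEmpty_or_nonempty T
  · exact ⟨1, one_pos, fun t => isEmptyElim t⟩
  · obtain ⟨t, ht⟩ := Finite.exists_min f
    exact ⟨f t, hf t, ht⟩

lemma exists_upper {T : Type*} [Finite T] (f : T → ℝ) (hf : ∀ t, 0 < f t) :
    ∃ V : ℝ, 0 < V ∧ ∀ t, f t ≤ V := by
  cases isEmpty_or_nonempty T
  · exact ⟨1, one_pos, fun t => isEmptyElim t⟩
  · obtain ⟨t, ht⟩ := Finite.exists_max f
    exact ⟨f t, hf t, ht⟩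

namespace GraphDirected

variable {X : Type*} [MetricSpace X] {p : ℕ} {r : ℝ} (G : GraphDirected X p r)

lemma lip (hr : 0 < r) (i j e) : LipschitzWith r.toNNReal (G.S i j e) :=
  LipschitzWith.of_dist_le_mul fun x y => by
    rw [G.sim i j e x y, Real.coe_toNNReal r hr.le]

lemma antilip (hr : 0 < r) (i j e) : AntilipschitzWith (r.toNNReal)⁻¹ (G.S i j e) :=
  AntilipschitzWith.of_le_mul_dist fun x y => by
    rw [G.sim i j e x y, NNReal.coe_inv, Real.coe_toNNReal r hr.le, inv_mul_cancel_left₀ hr.ne']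

lemma inj (hr : 0 < r) (i j e) : Function.Injective (G.S i j e) := (G.antilip hr i j e).injective

lemma mem_K {i j e y} (hy : y ∈ G.K j) : G.S i j e y ∈ G.K i := by
  rw [G.union i]
  simp only [mem_iUnion]
  exact ⟨j, e, y, hy, rfl⟩

lemma exists_pre {i x} (hx : x ∈ G.K i) :
    ∃ (e : Σ j, Fin (G.a i j)) (y : G.K e.1), G.S i e.1 e.2 y = x := by
  rw [G.union i] at hx
  simp only [mem_iUnion] at hx
  obtain ⟨j, e, y, hy, rfl⟩ := hx
  exact ⟨⟨j, e⟩, ⟨y, hy⟩, rfl⟩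

lemma union' (i : Fin p) : G.K i = ⋃ e : (Σ j, Fin (G.a i j)), G.S i e.1 e.2 '' G.K e.1 := by
  rw [iUnion_sigma]; exact G.union i

lemma sum_edges (i : Fin p) {M : Type*} [Semiring M] (w : Fin p → M) :
    ∑ e : (Σ j, Fin (G.a i j)), w e.1 = ∑ j, (G.a i j : M) * w j := by
  rw [Fintype.sum_sigma]
  simp

lemma exists_sep (hr : 0 < r) : ∃ δ : ℝ, 0 < δ ∧ ∀ i (e e' : Σ j, Fin (G.a i j)), e ≠ e' →
    ∀ y ∈ G.K e.1, ∀ y' ∈ G.K e'.1, δ ≤ dist (G.S i e.1 e.2 y) (G.S i e'.1 e'.2 y') := by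
  have key : ∀ t : (Σ i, (Σ j, Fin (G.a i j)) × (Σ j, Fin (G.a i j))), ∃ δ : ℝ, 0 < δ ∧
      (t.2.1 ≠ t.2.2 → ∀ y ∈ G.K t.2.1.1, ∀ y' ∈ G.K t.2.2.1,
        δ ≤ dist (G.S t.1 t.2.1.1 t.2.1.2 y) (G.S t.1 t.2.2.1 t.2.2.2 y')) := by
    rintro ⟨i, e, e'⟩
    by_cases h : e = e'
    · exact ⟨1, one_pos, fun h' => absurd h h'⟩
    · have hd := G.disj i e.1 e'.1 e.2 e'.2 h
      obtain ⟨δ, h0, h1⟩ := Metric.exists_pos_forall_lt_edist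
        ((G.compact e.1).image (G.lip hr i e.1 e.2).continuous)
        ((G.compact e'.1).image (G.lip hr i e'.1 e'.2).continuous).isClosed hd
      refine ⟨δ, h0, fun _ y hy y' hy' => ?_⟩
      have := h1 _ (mem_image_of_mem _ hy) _ (mem_image_of_mem _ hy')
      rw [edist_nndist] at this
      exact_mod_cast this.le
  choose f hf0 hf using key
  obtain ⟨δ, h0, h1⟩ := exists_lower f hf0
  exact ⟨δ, h0, fun i e e' hne y hy y' hy' => (h1 ⟨i, e, e'⟩).trans (hf ⟨i, e, e'⟩ hne y hy y' hy')⟩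

/-- existence of the coding functions. -/
lemma exists_coding (hr : 0 < r) (b : ∀ i, (Σ j, Fin (G.a i j)) → ℝ) (V : ℝ)
    (hb : ∀ i e, 0 ≤ b i e ∧ b i e ≤ V) (m : ℝ) (hm : 2 ≤ m) :
    ∃ f : Fin p → X → ℝ, (∀ i x, 0 ≤ f i x ∧ f i x ≤ 2 * V) ∧
      ∀ i (e : Σ j, Fin (G.a i j)), ∀ y ∈ G.K e.1,
        f i (G.S i e.1 e.2 y) = b i e + f e.1 y / m := by
  classical
  have hpre : ∀ z : (Σ i, G.K i), ∃ (e : Σ j, Fin (G.a z.1 j)) (y : G.K e.1),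
    G.S z.1 e.1 e.2 y = z.2 := fun z => G.exists_pre z.2.2
  choose E Y hEY using hpre
  let σ : (Σ i, G.K i) → (Σ i, G.K i) := fun z => ⟨(E z).1, Y z⟩
  let B : (Σ i, G.K i) → ℝ := fun z => b z.1 (E z)
  have hm0 : 0 < m := by linarith
  have hq0 : 0 ≤ m⁻¹ := by positivity
  have hq2 : m⁻¹ ≤ 2⁻¹ := inv_anti₀ (by norm_num) hm
  have hle : ∀ z n, B (σ^[n] z) * m⁻¹ ^ n ≤ V * (1 / 2) ^ n := by
    intro z n
    have h1 := hb (σ^[n] z).1 (E (σ^[n] z))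
    have h2 : m⁻¹ ^ n ≤ (1 / 2) ^ n := pow_le_pow_left₀ hq0 (by linarith) n
    exact mul_le_mul h1.2 h2 (by positivity) (h1.1.trans h1.2)
  have hnn : ∀ z n, 0 ≤ B (σ^[n] z) * m⁻¹ ^ n := fun z n =>
    mul_nonneg (hb (σ^[n] z).1 (E (σ^[n] z))).1 (by positivity)
  have hV : HasSum (fun n : ℕ => V * (1 / 2 : ℝ) ^ n) (V * 2) := hasSum_geometric_two.mul_left V
  have hsum : ∀ z, Summable fun n => B (σ^[n] z) * m⁻¹ ^ n := fun z =>
    Summable.of_nonneg_of_le (hnn z) (hle z) hV.summable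
  let F : (Σ i, G.K i) → ℝ := fun z => ∑' n, B (σ^[n] z) * m⁻¹ ^ n
  have hF : ∀ z, F z = B z + F (σ z) / m := by
    intro z
    show ∑' n, B (σ^[n] z) * m⁻¹ ^ n = B z + (∑' n, B (σ^[n] (σ z)) * m⁻¹ ^ n) / m
    rw [(hsum z).tsum_eq_zero_add, ← tsum_div_const]
    simp only [Function.iterate_zero, id, pow_zero, mul_one, Function.iterate_succ,
      Function.comp]
    congr 1
    refine tsum_congr fun n => ?_
    rw [pow_succ, div_eq_mul_inv]; ring
  have hFb : ∀ z, 0 ≤ F z ∧ F z ≤ 2 * V := by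
    intro z
    refine ⟨tsum_nonneg (hnn z), ?_⟩
    rw [mul_comm, ← hV.tsum_eq]
    exact (hsum z).tsum_le_tsum (hle z) hV.summable
  have huniq : ∀ z (e : Σ j, Fin (G.a z.1 j)) (y : G.K e.1), G.S z.1 e.1 e.2 y = z.2 →
      (⟨e.1, y⟩ : Σ i, G.K i) = σ z ∧ b z.1 e = B z := by
    intro z e y h
    show (⟨e.1, y⟩ : Σ i, G.K i) = ⟨(E z).1, Y z⟩ ∧ b z.1 e = b z.1 (E z)
    have h' := hEY z
    generalize hy' : Y z = y' at *
    clear hy'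
    generalize E z = e' at *
    have he : e = e' := by
      by_contra hne
      exact (disjoint_left.1 (G.disj z.1 e.1 e'.1 e.2 e'.2 hne))
        ⟨y, y.2, h⟩ ⟨y', y'.2, h'⟩
    subst he
    have : y = y' := Subtype.ext (G.inj hr _ _ _ (h.trans h'.symm))
    subst this
    exact ⟨rfl, rfl⟩
  have hV0 : ∀ z : (Σ i, G.K i), 0 ≤ V := fun z => (hb z.1 (E z)).1.trans (hb z.1 (E z)).2
  refine ⟨fun i x => if h : x ∈ G.K i then F ⟨i, x, h⟩ else 0, ?_, ?_⟩
  · intro i x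
    dsimp only
    split_ifs with h
    · exact hFb _
    · obtain ⟨x, hx⟩ := G.nonempty i
      have := hV0 ⟨i, x, hx⟩
      exact ⟨le_rfl, by linarith⟩
  · intro i e y hy
    have hS : G.S i e.1 e.2 y ∈ G.K i := G.mem_K hy
    simp only [dif_pos hS, dif_pos hy]
    have := huniq ⟨i, _, hS⟩ e ⟨y, hy⟩ rfl
    rw [hF, ← this.1, ← this.2]

lemma holder_aux (hr : 0 < r) (hr1 : r < 1) (b : ∀ i, (Σ j, Fin (G.a i j)) → ℝ) (V : ℝ)
    (m : ℝ) (hm : 2 ≤ m) (f : Fin p → X → ℝ) (hf : ∀ i x, 0 ≤ f i x ∧ f i x ≤ 2 * V)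
    (hfe : ∀ i (e : Σ j, Fin (G.a i j)), ∀ y ∈ G.K e.1,
        f i (G.S i e.1 e.2 y) = b i e + f e.1 y / m)
    (δ : ℝ) (hδ : 0 < δ) (hsep : ∀ i (e e' : Σ j, Fin (G.a i j)), e ≠ e' →
    ∀ y ∈ G.K e.1, ∀ y' ∈ G.K e'.1, δ ≤ dist (G.S i e.1 e.2 y) (G.S i e'.1 e'.2 y')) (n : ℕ) :
    ∀ i, ∀ x ∈ G.K i, ∀ x' ∈ G.K i, dist x x' < δ * r ^ n → |f i x - f i x'| ≤ 2 * V / m ^ n := by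
  have hm0 : 0 < m := by linarith
  induction n with
  | zero =>
    intro i x _ x' _ _
    have h1 := hf i x
    have h2 := hf i x'
    rw [abs_le]
    constructor <;> simp <;> linarith
  | succ n ih =>
    intro i x hx x' hx' hd
    obtain ⟨e, y, rfl⟩ := G.exists_pre hx
    obtain ⟨e', y', rfl⟩ := G.exists_pre hx'
    have he : e = e' := by
      by_contra hne
      have h1 := hsep i e e' hne y y.2 y' y'.2
      have h2 : δ * r ^ (n + 1) ≤ δ * 1 :=
        mul_le_mul_of_nonneg_left (pow_le_one₀ hr.le hr1.le) hδ.le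
      linarith
    subst he
    rw [G.sim] at hd
    have hd' : dist (y : X) y' < δ * r ^ n := by
      have : r * dist (y : X) y' < r * (δ * r ^ n) := by
        calc _ < _ := hd
          _ = _ := by ring
      exact lt_of_mul_lt_mul_left this hr.le
    have h3 := ih e.1 y y.2 y' y'.2 hd'
    rw [hfe i e y y.2, hfe i e y' y'.2]
    have : b i e + f e.1 y / m - (b i e + f e.1 y' / m) = (f e.1 y - f e.1 y') / m := by ring
    rw [this, abs_div, abs_of_pos hm0, pow_succ, ← div_div]
    exact div_le_div_of_nonneg_right h3 hm0.le

lemma dense_aux (b : ∀ i, (Σ j, Fin (G.a i j)) → ℝ) (V : ℝ) (v : Fin p → ℝ)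
    (hv : ∀ i, v i ≤ V) (hv0 : ∀ i, 0 < v i)
    (m : ℝ) (hm : 2 ≤ m) (f : Fin p → X → ℝ) (hf : ∀ i x, 0 ≤ f i x ∧ f i x ≤ 2 * V)
    (hfe : ∀ i (e : Σ j, Fin (G.a i j)), ∀ y ∈ G.K e.1,
        f i (G.S i e.1 e.2 y) = b i e + f e.1 y / m)
    (htile : ∀ i t, 0 ≤ t → t < v i → ∃ e, b i e ≤ t ∧ t < b i e + v e.1 / m) (n : ℕ) :
    ∀ i t, 0 ≤ t → t < v i → ∃ x ∈ G.K i, |f i x - t| ≤ 2 * V / m ^ n := by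
  have hm0 : 0 < m := by linarith
  induction n with
  | zero =>
    intro i t h0 h1
    obtain ⟨x, hx⟩ := G.nonempty i
    refine ⟨x, hx, ?_⟩
    have h2 := hf i x
    have h3 := hv i
    have h4 := hv0 i
    rw [abs_le]
    constructor <;> simp <;> linarith
  | succ n ih =>
    intro i t h0 h1
    obtain ⟨e, h2, h3⟩ := htile i t h0 h1
    have h5 : (t - b i e) * m < v e.1 := by
      rw [← lt_div_iff₀ hm0]; linarith
    obtain ⟨y, hy, h4⟩ := ih e.1 ((t - b i e) * m) (mul_nonneg (by linarith) hm0.le) h5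
    refine ⟨G.S i e.1 e.2 y, G.mem_K hy, ?_⟩
    rw [hfe i e y hy]
    have : b i e + f e.1 y / m - t = (f e.1 y - (t - b i e) * m) / m := by
      field_simp; ring
    rw [this, abs_div, abs_of_pos hm0, pow_succ, ← div_div]
    exact div_le_div_of_nonneg_right h4 hm0.le

lemma holder (hr : 0 < r) (hr1 : r < 1) (V : ℝ) (hV : 0 < V)
    (m : ℝ) (hm : 2 ≤ m) (f : Fin p → X → ℝ) (hf : ∀ i x, 0 ≤ f i x ∧ f i x ≤ 2 * V)
    (δ : ℝ) (hδ : 0 < δ) (s : ℝ≥0) (hs : 0 < s) (hms : r ^ (s : ℝ) = m⁻¹)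
    (h : ∀ n : ℕ, ∀ i, ∀ x ∈ G.K i, ∀ x' ∈ G.K i, dist x x' < δ * r ^ n →
      |f i x - f i x'| ≤ 2 * V / m ^ n) (i : Fin p) :
    ∃ C : ℝ≥0, HolderOnWith C s (f i) (G.K i) := by
  have hm0 : 0 < m := by linarith
  have hδs : 0 < δ ^ (s : ℝ) := Real.rpow_pos_of_pos hδ _
  have hC : 0 ≤ 2 * V * m ^ 2 / δ ^ (s : ℝ) := by positivity
  refine ⟨(2 * V * m ^ 2 / δ ^ (s : ℝ)).toNNReal, ?_⟩
  intro x hx y hy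
  have key : dist (f i x) (f i y) ≤ 2 * V * m ^ 2 / δ ^ (s : ℝ) * dist x y ^ (s : ℝ) := by
    by_cases hxy : x = y
    · subst hxy
      simp only [dist_self]
      positivity
    have hd : 0 < dist x y := dist_pos.2 hxy
    rw [Real.dist_eq]
    have e : 2 * V * m ^ 2 / δ ^ (s : ℝ) * dist x y ^ (s : ℝ)
        = 2 * V * m ^ 2 * (dist x y / δ) ^ (s : ℝ) := by
      rw [Real.div_rpow hd.le hδ.le]; ring
    rw [e]
    by_cases h1 : dist x y / δ ≤ 1
    · obtain ⟨n, hn1, hn2⟩ := exists_nat_pow_near_of_lt_one (div_pos hd hδ) h1 hr hr1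
      have h3 : (m ^ (n + 1))⁻¹ ≤ (dist x y / δ) ^ (s : ℝ) := by
        calc (m ^ (n + 1))⁻¹ = (r ^ (n + 1)) ^ (s : ℝ) := by
              rw [← Real.rpow_natCast r, ← Real.rpow_mul hr.le, mul_comm,
                Real.rpow_mul hr.le, hms, Real.rpow_natCast, inv_pow]
          _ ≤ _ := Real.rpow_le_rpow (by positivity) hn1.le s.coe_nonneg
      have h4 : |f i x - f i y| ≤ 2 * V * m / m ^ n := by
        cases n with
        | zero =>
          have h1 := hf i x
          have h2 := hf i y
          rw [pow_zero, div_one]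
          have : 2 * V ≤ 2 * V * m := by nlinarith
          rw [abs_le]
          constructor <;> linarith
        | succ n =>
          have : dist x y < δ * r ^ n := by
            rw [div_le_iff₀ hδ] at hn2
            have : r ^ (n + 1) < r ^ n := pow_lt_pow_right_of_lt_one₀ hr hr1 (Nat.lt_succ_self n)
            nlinarith
          refine (h n i x hx y hy this).trans (le_of_eq ?_)
          field_simp; ring
      calc _ ≤ _ := h4
        _ = 2 * V * m ^ 2 * (m ^ (n + 1))⁻¹ := by field_simp; ring
        _ ≤ _ := by gcongr
    · have h2 : 1 ≤ (dist x y / δ) ^ (s : ℝ) := Real.one_le_rpow (not_le.1 h1).le s.coe_nonneg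
      have h3 : |f i x - f i y| ≤ 2 * V := by
        have h1 := hf i x
        have h2 := hf i y
        rw [abs_le]
        constructor <;> linarith
      have h5 : 1 ≤ m ^ 2 := by nlinarith
      calc _ ≤ 2 * V * 1 * 1 := by linarith
        _ ≤ _ := by gcongr
  rw [edist_dist, edist_dist, ENNReal.ofReal_rpow_of_nonneg dist_nonneg s.coe_nonneg]
  have : ((2 * V * m ^ 2 / δ ^ (s : ℝ)).toNNReal : ℝ≥0∞) =
    ENNReal.ofReal (2 * V * m ^ 2 / δ ^ (s : ℝ)) := rfl
  rw [this, ← ENNReal.ofReal_mul hC]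
  exact ENNReal.ofReal_le_ofReal key

lemma pos_measure [MeasurableSpace X] [BorelSpace X] (hr : 0 < r) (hr1 : r < 1)
    (m : ℝ) (hm : 2 ≤ m) (s : ℝ) (hs : 0 < s) (hms : r ^ s = m⁻¹)
    (v : Fin p → ℝ) (hv0 : ∀ i, 0 < v i) (hv : ∀ i, ∑ j, (G.a i j : ℝ) * v j = m * v i)
    (i : Fin p) : 0 < μH[s] (G.K i) := by
  have hm0 : 0 < m := by linarith
  obtain ⟨V, hV, hvV⟩ := exists_upper v hv0
  have hsum : ∀ i, ∑ e : (Σ j, Fin (G.a i j)), v e.1 / m = v i := by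
    intro i
    rw [← Finset.sum_div, G.sum_edges i v, hv i]
    field_simp
  have ht := fun i => exists_tiling (Finset.univ : Finset (Σ j, Fin (G.a i j)))
    (fun e => v e.1 / m) (fun e => (div_pos (hv0 _) hm0).le)
  choose b hb htile using ht
  simp only [hsum] at hb htile
  obtain ⟨f, hf, hfe⟩ := G.exists_coding hr b V
    (fun i e => ⟨(hb i e).1, (hb i e).2.trans (hvV i)⟩) m hm
  obtain ⟨δ, hδ, hsep⟩ := G.exists_sep hr
  have hh := G.holder_aux hr hr1 b V m hm f hf hfe δ hδ hsep
  obtain ⟨C, hC⟩ := G.holder hr hr1 V hV m hm f hf δ hδ ⟨s, hs.le⟩ hs hms hh i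
  have hd := G.dense_aux b V v hvV hv0 m hm f hf hfe
    (fun i t h0 h1 => by obtain ⟨e, _, he⟩ := htile i t h0 h1; exact ⟨e, he⟩)
  have hcl : IsClosed (f i '' G.K i) :=
    ((G.compact i).image_of_continuousOn (hC.continuousOn hs)).isClosed
  have hsub : Ico 0 (v i) ⊆ f i '' G.K i := by
    intro t ht
    rw [← hcl.closure_eq, Metric.mem_closure_iff]
    intro ε hε
    have hlim : Tendsto (fun n : ℕ => 2 * V / m ^ n) atTop (𝓝 0) :=
      Tendsto.const_div_atTop (tendsto_pow_atTop_atTop_of_one_lt (by linarith)) _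
    obtain ⟨n, hn⟩ := (hlim.eventually_lt_const hε).exists
    obtain ⟨x, hx, hxt⟩ := hd n i t ht.1 ht.2
    refine ⟨_, mem_image_of_mem _ hx, ?_⟩
    rw [dist_comm, Real.dist_eq]
    linarith
  have h1 := hC.hausdorffMeasure_image_le hs (d := 1) zero_le_one
  rw [hausdorffMeasure_real] at h1
  have h2 := (measure_mono (μ := volume) hsub).trans h1
  rw [Real.volume_Ico, ENNReal.rpow_one, mul_one] at h2
  refine pos_iff_ne_zero.2 fun h0 => ?_
  change _ ≤ (C : ℝ≥0∞) * μH[s] (G.K i) at h2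
  rw [h0, mul_zero] at h2
  simp only [sub_zero, nonpos_iff_eq_zero, ENNReal.ofReal_eq_zero] at h2
  linarith [hv0 i]

lemma exists_cover [CompactSpace X] (hr : 0 < r)
    (m : ℝ) (v : Fin p → ℝ) (c : ℝ) (hc : ∀ i, c ≤ v i)
    (hv : ∀ i, ∑ j, (G.a i j : ℝ) * v j = m * v i) (n : ℕ) :
    ∀ i, ∃ (β : Type) (_ : Fintype β) (t : β → Set X), G.K i ⊆ ⋃ k, t k ∧
      (∀ k, Metric.ediam (t k) ≤ ENNReal.ofReal r ^ n * Metric.ediam (univ : Set X)) ∧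
      (Fintype.card β : ℝ) * c ≤ m ^ n * v i := by
  induction n with
  | zero =>
    intro i
    refine ⟨Unit, inferInstance, fun _ => univ, ?_, ?_, ?_⟩
    · intro x _; simp
    · simp
    · simpa using hc i
  | succ n ih =>
    intro i
    choose β hβ t h1 h2 h3 using ih
    refine ⟨Σ e : (Σ j, Fin (G.a i j)), β e.1, inferInstance,
      fun k => G.S i k.1.1 k.1.2 '' t k.1.1 k.2, ?_, ?_, ?_⟩
    · intro x hx
      obtain ⟨e, y, rfl⟩ := G.exists_pre hx
      obtain ⟨k, hk⟩ := mem_iUnion.1 (h1 e.1 y.2)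
      exact mem_iUnion.2 ⟨⟨e, k⟩, mem_image_of_mem _ hk⟩
    · rintro ⟨e, k⟩
      refine ((G.lip hr i e.1 e.2).ediam_image_le _).trans ?_
      have : (r.toNNReal : ℝ≥0∞) = ENNReal.ofReal r := rfl
      rw [this, pow_succ', mul_assoc]
      gcongr
      exact h2 _ _
    · rw [Fintype.card_sigma]
      push_cast
      rw [Finset.sum_mul]
      calc _ ≤ ∑ e : (Σ j, Fin (G.a i j)), m ^ n * v e.1 := Finset.sum_le_sum fun e _ => h3 e.1
        _ = _ := by rw [← Finset.mul_sum, G.sum_edges i v, hv i]; ring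

lemma finite_measure [CompactSpace X] [MeasurableSpace X] [BorelSpace X] (hr : 0 < r) (hr1 : r < 1)
    (m : ℝ) (hm : 2 ≤ m) (s : ℝ) (hs : 0 < s) (hms : r ^ s = m⁻¹)
    (v : Fin p → ℝ) (hv0 : ∀ i, 0 < v i) (hv : ∀ i, ∑ j, (G.a i j : ℝ) * v j = m * v i)
    (i : Fin p) : μH[s] (G.K i) < ⊤ := by
  have hm0 : 0 < m := by linarith
  obtain ⟨c, hc0, hc⟩ := exists_lower v hv0
  have H := fun n => G.exists_cover hr m v c hc hv n i
  choose β hβ t h1 h2 h3 using H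
  have hD : Metric.ediam (univ : Set X) ≠ ⊤ := isCompact_univ.isBounded.ediam_ne_top
  set D := Metric.ediam (univ : Set X)
  have hlim : Tendsto (fun n : ℕ => ENNReal.ofReal r ^ n * D) atTop (𝓝 0) := by
    have := ENNReal.Tendsto.mul_const (b := D) (ENNReal.tendsto_pow_atTop_nhds_zero_of_lt_one
      (r := ENNReal.ofReal r) (by simpa using hr1)) (Or.inr hD)
    simpa using this
  have hle := Measure.hausdorffMeasure_le_liminf_sum s (G.K i) _ hlim t
    (Eventually.of_forall h2) (Eventually.of_forall h1)
  refine hle.trans_lt ?_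
  have hbound : ∀ n, ∑ k, Metric.ediam (t n k) ^ s ≤ ENNReal.ofReal (v i / c) * D ^ s := by
    intro n
    have hp : (ENNReal.ofReal r ^ n) ^ s = ENNReal.ofReal (m ^ n)⁻¹ := by
      rw [← ENNReal.ofReal_pow hr.le, ENNReal.ofReal_rpow_of_pos (by positivity)]
      rw [← Real.rpow_natCast r, ← Real.rpow_mul hr.le, mul_comm,
                Real.rpow_mul hr.le, hms, Real.rpow_natCast, inv_pow]
    calc ∑ k, Metric.ediam (t n k) ^ s ≤ ∑ k : β n, ENNReal.ofReal (m ^ n)⁻¹ * D ^ s := by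
          refine Finset.sum_le_sum fun k _ => ?_
          rw [← hp, ← ENNReal.mul_rpow_of_nonneg _ _ hs.le]
          exact ENNReal.rpow_le_rpow (h2 n k) hs.le
      _ = ENNReal.ofReal (Fintype.card (β n) * (m ^ n)⁻¹) * D ^ s := by
          rw [Finset.sum_const, nsmul_eq_mul, ENNReal.ofReal_mul (by positivity),
            ENNReal.ofReal_natCast, mul_assoc, Finset.card_univ]
      _ ≤ _ := by
          gcongr
          rw [← div_eq_mul_inv, div_le_div_iff₀ (by positivity) hc0]
          linarith [h3 n]
  refine (liminf_le_of_frequently_le' (Frequently.of_forall hbound)).trans_lt ?_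
  exact ENNReal.mul_lt_top ENNReal.ofReal_lt_top (ENNReal.rpow_lt_top_of_nonneg hs.le hD)

lemma measure_image [MeasurableSpace X] [BorelSpace X] (hr : 0 < r)
    (s : ℝ) (hs : 0 < s) (i j e) (K : Set X) :
    μH[s] (G.S i j e '' K) = ENNReal.ofReal (r ^ s) * μH[s] K := by
  have hc : (r.toNNReal : ℝ≥0∞) = ENNReal.ofReal r := rfl
  have hne : r.toNNReal ≠ 0 := (Real.toNNReal_pos.2 hr).ne'
  rw [← ENNReal.ofReal_rpow_of_pos hr]
  have h0 : ENNReal.ofReal r ^ s ≠ 0 := by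
    rw [ENNReal.ofReal_rpow_of_pos hr]; simpa using Real.rpow_pos_of_pos hr s
  have ht : ENNReal.ofReal r ^ s ≠ ⊤ := ENNReal.rpow_ne_top_of_nonneg hs.le ENNReal.ofReal_ne_top
  apply le_antisymm
  · have := (G.lip hr i j e).hausdorffMeasure_image_le hs.le K
    rwa [hc] at this
  · have := (G.antilip hr i j e).le_hausdorffMeasure_image hs.le K
    rw [ENNReal.coe_inv hne, hc, ENNReal.inv_rpow] at this
    calc _ ≤ ENNReal.ofReal r ^ s * ((ENNReal.ofReal r ^ s)⁻¹ * μH[s] (G.S i j e '' K)) := by gcongr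
      _ = _ := by rw [← mul_assoc, ENNReal.mul_inv_cancel h0 ht, one_mul]

lemma measure_eq [MeasurableSpace X] [BorelSpace X] (hr : 0 < r)
    (s : ℝ) (hs : 0 < s) (i : Fin p) :
    μH[s] (G.K i) = ENNReal.ofReal (r ^ s) * ∑ j, (G.a i j : ℝ≥0∞) * μH[s] (G.K j) := by
  conv_lhs => rw [G.union' i]
  rw [measure_iUnion, tsum_fintype]
  · simp only [G.measure_image hr s hs]
    rw [← Finset.mul_sum, G.sum_edges i (fun j => μH[s] (G.K j))]
  · intro e e' hne
    exact G.disj i e.1 e'.1 e.2 e'.2 hne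
  · intro e
    exact ((G.compact e.1).image (G.lip hr i e.1 e.2).continuous).isClosed.measurableSet

end GraphDirected

/-- **Equivalence of the two definitions of integer characteristic.** Let
`K_1, …, K_p` be dust-like graph-directed sets with ratio `r ∈ (0,1)` and
adjacency matrix `A`, let `m ≥ 2` be an integer and `s = − log m / log r`.
Then there is a positive vector `v` with `A v = m v` iff
`0 < 𝓗^s(K_i) < ∞` for every `i`. -/
theorem characteristic_iff_hausdorffMeasure
    {X : Type*} [MetricSpace X] [CompactSpace X] [MeasurableSpace X] [BorelSpace X]
    {p : ℕ} {r : ℝ} (hr : r ∈ Set.Ioo (0 : ℝ) 1) {m : ℕ} (hm : 2 ≤ m)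
    (G : GraphDirected X p r) (s : ℝ) (hs : s = -Real.log m / Real.log r) :
    G.HasCharacteristic m ↔
      ∀ i : Fin p, 0 < μH[s] (G.K i) ∧ μH[s] (G.K i) < ⊤ := by
  obtain ⟨hr0, hr1⟩ := hr
  have hm' : (2 : ℝ) ≤ m := by exact_mod_cast hm
  have hm0 : (0 : ℝ) < m := by linarith
  have hlr : Real.log r < 0 := Real.log_neg hr0 hr1
  have hlm : 0 < Real.log m := Real.log_pos (by linarith)
  have hs0 : 0 < s := by
    rw [hs]; exact div_pos_of_neg_of_neg (by linarith) hlr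
  have hms : r ^ s = (m : ℝ)⁻¹ := by
    rw [Real.rpow_def_of_pos hr0, hs, mul_div_cancel₀ _ hlr.ne, Real.exp_neg, Real.exp_log hm0]
  constructor
  · rintro ⟨v, hv0, hv⟩ i
    exact ⟨G.pos_measure hr0 hr1 m hm' s hs0 hms v hv0 hv i,
      G.finite_measure hr0 hr1 m hm' s hs0 hms v hv0 hv i⟩
  · intro h
    refine ⟨fun i => (μH[s] (G.K i)).toReal, fun i => ENNReal.toReal_pos (h i).1.ne' (h i).2.ne, ?_⟩
    intro i
    have := congrArg ENNReal.toReal (G.measure_eq hr0 s hs0 i)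
    rw [hms, ENNReal.toReal_mul, ENNReal.toReal_ofReal (by positivity), ENNReal.toReal_sum] at this
    · simp only [ENNReal.toReal_mul, ENNReal.toReal_natCast] at this
      beta_reduce
      rw [this, mul_inv_cancel_left₀ hm0.ne']
    · intro j _
      exact ENNReal.mul_ne_top (ENNReal.natCast_ne_top _) (h j).2.ne
end

section
/- Let K_1, …, K_p be dust-like graph-directed sets with ratio r ∈ (0,1) and integer characteristic m ≥ 2 whose adjacency matrix A is irreducible (equivalently, the directed graph is transitive: for any two vertices i, j there is a directed path from i to j). Then each K_i is bilipschitz equivalent to the symbolic space Σ_m^r. -/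
open scoped Classical

theorem gd_greedy {I : Type*} (w : I → ℕ) (M : ℕ) (s : Finset I) (hw : ∀ i ∈ s, w i ≤ M) (T : ℕ)
    (hT : T ≤ ∑ i ∈ s, w i) : ∃ B ⊆ s, ∑ i ∈ B, w i ≤ T ∧ T ≤ ∑ i ∈ B, w i + M := by
  induction s using Finset.induction_on with
  | empty => exact ⟨∅, by simp, by simp, by simp at hT; simp [hT]⟩
  | insert a s ha ih =>
    by_cases h : T ≤ ∑ i ∈ s, w i
    · obtain ⟨B, hB, h1⟩ := ih (fun i hi => hw i (Finset.mem_insert_of_mem hi)) h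
      exact ⟨B, hB.trans (Finset.subset_insert _ _), h1⟩
    · rw [Finset.sum_insert ha] at hT
      have := hw a (Finset.mem_insert_self _ _)
      exact ⟨s, Finset.subset_insert _ _, by omega, by omega⟩

theorem gd_pick {I : Type*} (w : I → ℕ) (W : Finset ℕ) (T : Finset I) (c : ℕ → ℕ)
    (hc : ∀ u ∈ W, c u ≤ (T.filter (fun i => w i = u)).card) :
    ∃ C ⊆ T, (∀ u ∈ W, (C.filter (fun i => w i = u)).card = c u) ∧
      ∑ i ∈ C, w i = ∑ u ∈ W, c u * u := by
  have : ∀ u, ∃ D : Finset I, u ∈ W → D ⊆ T.filter (fun i => w i = u) ∧ D.card = c u := by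
    intro u
    by_cases hu : u ∈ W
    · obtain ⟨D, h⟩ := Finset.exists_subset_card_eq (hc u hu)
      exact ⟨D, fun _ => h⟩
    · exact ⟨∅, fun h => absurd h hu⟩
  choose D hD using this
  have hwD : ∀ u ∈ W, ∀ i ∈ D u, i ∈ T ∧ w i = u := fun u hu i hi => by
    simpa using (hD u hu).1 hi
  have hfil : ∀ u ∈ W, (W.biUnion D).filter (fun i => w i = u) = D u := by
    intro u hu
    ext i
    simp only [Finset.mem_filter, Finset.mem_biUnion]
    constructor
    · rintro ⟨⟨u', hu', hi⟩, hw⟩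
      have := (hwD u' hu' i hi).2
      have : u' = u := by omega
      exact this ▸ hi
    · intro hi
      exact ⟨⟨u, hu, hi⟩, (hwD u hu i hi).2⟩
  refine ⟨W.biUnion D, ?_, ?_, ?_⟩
  · intro i hi
    obtain ⟨u, hu, hi⟩ := Finset.mem_biUnion.1 hi
    exact (hwD u hu i hi).1
  · intro u hu
    rw [hfil u hu, (hD u hu).2]
  · rw [← Finset.sum_fiberwise_of_maps_to (t := W) (g := w)]
    · refine Finset.sum_congr rfl fun u hu => ?_
      rw [hfil u hu, Finset.sum_congr rfl (fun i hi => (hwD u hu i hi).2)]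
      simp [(hD u hu).2]
    · intro i hi
      obtain ⟨u, hu, hi⟩ := Finset.mem_biUnion.1 hi
      rw [(hwD u hu i hi).2]; exact hu

theorem gd_part {I : Type*} (w : I → ℕ) (W : Finset ℕ) (M F N g : ℕ)
    (hW : ∀ u ∈ W, 0 < u ∧ u ≤ M)
    (hF : ∀ n ≥ F, g ∣ n → ∃ c : ℕ → ℕ, ∑ u ∈ W, c u * u = n)
    (hgN : g ∣ N) (hFN : F ≤ N) (hN : 2 * (M * (F + M) * M) ≤ N) (q : ℕ) :
    ∀ s : Finset I, (∀ i ∈ s, w i ≤ M ∧ g ∣ w i) → ∑ i ∈ s, w i = (q + 1) * N →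
    (∀ u ∈ W, (q + 1) * (F + M) ≤ (s.filter (fun i => w i = u)).card) →
    ∃ f : I → ℕ, (∀ i ∈ s, f i < q + 1) ∧ ∀ τ < q + 1, ∑ i ∈ s.filter (fun i => f i = τ), w i = N := by
  induction q with
  | zero =>
    intro s _ h _
    refine ⟨fun _ => 0, by simp, fun τ hτ => ?_⟩
    have : τ = 0 := by omega
    subst this
    simpa using h
  | succ q ih =>
    intro s hs hsum hrich
    obtain ⟨T, hTs, hTc, hTsum⟩ := gd_pick w W s (fun _ => (q + 1 + 1) * (F + M)) hrich
    have hWc : W.card ≤ M := by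
      have : W ⊆ Finset.Icc 1 M := fun u hu => by
        have := hW u hu; simp; omega
      simpa using Finset.card_le_card this
    have hT1 : ∑ i ∈ T, w i ≤ (q + 1 + 1) * (M * (F + M) * M) := by
      rw [hTsum]
      calc _ ≤ ∑ u ∈ W, (q + 1 + 1) * (F + M) * M :=
            Finset.sum_le_sum fun u hu => Nat.mul_le_mul_left _ (hW u hu).2
        _ = W.card * ((q + 1 + 1) * (F + M) * M) := by simp
        _ ≤ M * ((q + 1 + 1) * (F + M) * M) := Nat.mul_le_mul_right _ hWc
        _ = _ := by ring
    have hpool : ∑ i ∈ s \ T, w i + ∑ i ∈ T, w i = (q + 1 + 1) * N := by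
      rw [Finset.sum_sdiff hTs, hsum]
    have hpN : N - F ≤ ∑ i ∈ s \ T, w i := by
      have h2 := Nat.mul_le_mul_left (q + 1 + 1) hN
      have h3 : 2 * N ≤ (q + 1 + 1) * N := Nat.mul_le_mul_right _ (by omega)
      have h4 : (q + 1 + 1) * (2 * (M * (F + M) * M)) = 2 * ((q + 1 + 1) * (M * (F + M) * M)) := by
        ring
      omega
    obtain ⟨B, hB, hB1, hB2⟩ := gd_greedy w M (s \ T)
      (fun i hi => (hs i (Finset.sdiff_subset hi)).1) (N - F) hpN
    have hBs : B ⊆ s := hB.trans Finset.sdiff_subset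
    have hgB : g ∣ ∑ i ∈ B, w i := Finset.dvd_sum fun i hi => (hs i (hBs hi)).2
    obtain ⟨c, hc⟩ := hF (N - ∑ i ∈ B, w i) (by omega) (Nat.dvd_sub hgN hgB)
    have hcle : ∀ u ∈ W, c u ≤ F + M := by
      intro u hu
      have h1 : c u * u ≤ ∑ u ∈ W, c u * u :=
        Finset.single_le_sum (f := fun u => c u * u) (fun _ _ => Nat.zero_le _) hu
      have h2 : c u * 1 ≤ c u * u := Nat.mul_le_mul_left _ (hW u hu).1
      omega
    obtain ⟨C, hCT, hCc, hCsum⟩ := gd_pick w W T c (fun u hu => by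
      rw [hTc u hu]
      have := hcle u hu
      nlinarith)
    have hdisj : Disjoint B C := by
      refine Finset.disjoint_left.2 fun i hi hi' => ?_
      exact (Finset.mem_sdiff.1 (hB hi)).2 (hCT hi')
    have hBC : B ∪ C ⊆ s := Finset.union_subset hBs (hCT.trans hTs)
    have hBCsum : ∑ i ∈ B ∪ C, w i = N := by
      rw [Finset.sum_union hdisj]; omega
    have hrest : ∑ i ∈ s \ (B ∪ C), w i = (q + 1) * N := by
      have := Finset.sum_sdiff hBC (f := w)
      rw [hBCsum, hsum] at this
      have h : (q + 1 + 1) * N = (q + 1) * N + N := by ring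
      omega
    obtain ⟨f, hf1, hf2⟩ := ih (s \ (B ∪ C)) (fun i hi => hs i (Finset.sdiff_subset hi)) hrest (by
      intro u hu
      have hsub : (T.filter (fun i => w i = u)) \ (C.filter (fun i => w i = u)) ⊆
          (s \ (B ∪ C)).filter (fun i => w i = u) := by
        intro i hi
        simp only [Finset.mem_sdiff, Finset.mem_filter, Finset.mem_union] at hi ⊢
        refine ⟨⟨hTs hi.1.1, ?_⟩, hi.1.2⟩
        rintro (h | h)
        · exact (Finset.mem_sdiff.1 (hB h)).2 hi.1.1
        · exact hi.2 ⟨h, hi.1.2⟩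
      have h1 := Finset.card_le_card hsub
      have h2 := Finset.le_card_sdiff (C.filter (fun i => w i = u)) (T.filter (fun i => w i = u))
      rw [hTc u hu, hCc u hu] at h2
      have := hcle u hu
      have h : (q + 1 + 1) * (F + M) = (q + 1) * (F + M) + (F + M) := by ring
      omega)
    refine ⟨fun i => if i ∈ B ∪ C then q + 1 else f i, ?_, ?_⟩
    · intro i hi
      by_cases h : i ∈ B ∪ C
      · simp only [h, if_true]; omega
      · simp only [h, if_false]
        have := hf1 i (Finset.mem_sdiff.2 ⟨hi, h⟩); omega
    · intro τ hτ
      by_cases h : τ = q + 1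
      · rw [← hBCsum]
        congr 1
        ext i
        simp only [Finset.mem_filter]
        constructor
        · rintro ⟨h1, h2⟩
          by_contra h3
          rw [if_neg h3] at h2
          have := hf1 i (Finset.mem_sdiff.2 ⟨h1, h3⟩); omega
        · intro h1
          exact ⟨hBC h1, by rw [if_pos h1, h]⟩
      · rw [← hf2 τ (by omega)]
        congr 1
        ext i
        simp only [Finset.mem_filter, Finset.mem_sdiff]
        constructor
        · rintro ⟨h1, h2⟩
          by_cases h3 : i ∈ B ∪ C
          · rw [if_pos h3] at h2; omega
          · rw [if_neg h3] at h2; exact ⟨⟨h1, h3⟩, h2⟩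
        · rintro ⟨⟨h1, h3⟩, h2⟩
          exact ⟨h1, by rw [if_neg h3]; exact h2⟩


def GDCE {Y Z : Type*} (E : ℕ → Y → Y → Prop) (F : ℕ → Z → Z → Prop) : Prop :=
  ∃ f : Y → Z, Function.Bijective f ∧ ∃ b : ℕ, ∀ n x y,
    (E (n + b) x y → F n (f x) (f y)) ∧ (F (n + b) (f x) (f y) → E n x y)

theorem GDCE.trans' {Y Z V : Type*} {E : ℕ → Y → Y → Prop} {F : ℕ → Z → Z → Prop}
    {H : ℕ → V → V → Prop} (h1 : GDCE E F) (h2 : GDCE F H) : GDCE E H := by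
  obtain ⟨f, hf, b, hb⟩ := h1
  obtain ⟨g, hg, d, hd⟩ := h2
  refine ⟨g ∘ f, hg.comp hf, b + d, fun n x y => ⟨fun h => ?_, fun h => ?_⟩⟩
  · exact (hd n _ _).1 ((hb (n + d) x y).1 (by rwa [add_assoc, add_comm d b]))
  · exact (hb n x y).2 ((hd (n + b) _ _).2 (by rwa [add_assoc]))

/-- agreement of sequences on the first `n` digits -/
def gdAg {A : Type*} (n : ℕ) (x y : ℕ → A) : Prop := ∀ k < n, x k = y k

def gdAgw {A : Type*} {w : ℕ} (n : ℕ) (x y : Fin w × (ℕ → A)) : Prop :=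
  (0 < n → x.1 = y.1) ∧ ∀ k < n, x.2 k = y.2 k

def gdAgc {A : Type*} {w : ℕ} (c : ℕ) (n : ℕ) (x y : Fin w × (ℕ → A)) : Prop :=
  (0 < n → x.1 = y.1) ∧ ∀ k, c * k < n → x.2 k = y.2 k

theorem gd_flat {m c w : ℕ} (hc : 0 < c) :
    GDCE (gdAgc (A := Fin c → Fin m) (w := w) c) (gdAgw (A := Fin m) (w := w)) := by
  refine ⟨fun x => (x.1, fun k => x.2 (k / c) ⟨k % c, Nat.mod_lt _ hc⟩), ⟨?_, ?_⟩, c, ?_⟩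
  · rintro ⟨a, x⟩ ⟨b, y⟩ h
    simp only [Prod.mk.injEq] at h
    refine Prod.ext h.1 ?_
    funext k i
    have := congrFun h.2 (c * k + i)
    simpa [Nat.mul_add_div hc, Nat.div_eq_of_lt i.2, Nat.mod_eq_of_lt i.2] using this
  · rintro ⟨a, y⟩
    refine ⟨(a, fun k i => y (c * k + i)), ?_⟩
    refine Prod.ext rfl ?_
    funext k
    simp [Nat.div_add_mod]
  · intro n x y
    refine ⟨fun h => ⟨fun hn => h.1 (by omega), fun k hk => ?_⟩,
      fun h => ⟨fun hn => h.1 (by omega), fun k hk => ?_⟩⟩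
    · have := h.2 (k / c) (by have := Nat.mul_div_le k c; omega)
      simp only [this]
    · funext i
      have := h.2 (c * k + i) (by have := i.2; omega)
      simpa [Nat.mul_add_div hc, Nat.div_eq_of_lt i.2, Nat.mod_eq_of_lt i.2] using this

/-- Hilbert hotel transducer -/
def gdH {m : ℕ} : ℕ → (ℕ → Fin (m + 2)) → Fin (m + 2)
  | 0, x => if x 0 = 0 then 0 else x 0 + 1
  | k + 1, x => if x 0 = 0 then gdH k (fun j => x (j + 1)) else
      if x 0 = Fin.last (m + 1) then (if k = 0 then 1 else x k) else x (k + 1)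

def gdH' {m : ℕ} : ℕ → (ℕ → Fin (m + 2)) → Fin (m + 2)
  | 0, y => if y 0 = 0 then (if y 1 = 1 then Fin.last (m + 1) else 0) else y 0 - 1
  | k + 1, y => if y 0 = 0 then (if y 1 = 1 then y (k + 2) else gdH' k (fun j => y (j + 1)))
      else y (k + 1)

theorem gdH_ne_one {m : ℕ} (x : ℕ → Fin (m + 2)) : gdH 0 x ≠ 1 := by
  simp only [gdH]
  split_ifs with h
  · simp
  · intro h'; apply h; simpa using h'

theorem gdH_H' {m : ℕ} (k : ℕ) : ∀ y : ℕ → Fin (m + 2), y 0 ≠ 1 →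
    gdH k (fun j => gdH' j y) = y k := by
  induction k with
  | zero =>
    intro y hy
    by_cases h0 : y 0 = 0
    · by_cases h1 : y 1 = 1
      · simp [gdH, gdH', h0, h1]
      · simp [gdH, gdH', h0, h1]
    · have : y 0 - 1 ≠ 0 := fun h => hy (sub_eq_zero.1 h)
      simp [gdH, gdH', h0, this]
  | succ k ih =>
    intro y hy
    by_cases h0 : y 0 = 0
    · by_cases h1 : y 1 = 1
      · have : Fin.last (m + 1) ≠ 0 := by simp [Fin.ext_iff]
        rcases k with _ | k
        · simp [gdH, gdH', h0, h1]
        · simp [gdH, gdH', h0, h1]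
      · have := ih (fun j => y (j + 1)) h1
        simp only [gdH]
        rw [if_pos (by simp [gdH', h0, h1])]
        simpa [gdH', h0, h1] using this
    · have h2 : y 0 - 1 ≠ 0 := fun h => hy (sub_eq_zero.1 h)
      have h3 : y 0 - 1 ≠ Fin.last (m + 1) := fun h => h0 (by
        have := sub_eq_iff_eq_add.1 h
        rw [this]; simp)
      simp [gdH, gdH', h0, h2, h3]

theorem gdH_fwd {m : ℕ} (n : ℕ) : ∀ x y : ℕ → Fin (m + 2), gdAg (n + 1) x y →
    ∀ k < n + 1, gdH k x = gdH k y := by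
  induction n with
  | zero =>
    intro x y h k hk
    have : k = 0 := by omega
    subst this
    simp [gdH, h 0 (by omega)]
  | succ n ih =>
    intro x y h k hk
    have h0 := h 0 (by omega)
    rcases k with _ | k
    · simp [gdH, h0]
    · simp only [gdH, ← h0]
      have h1 := h k (by omega)
      have h2 := h (k + 1) (by omega)
      rw [ih (fun j => x (j + 1)) (fun j => y (j + 1)) (fun j hj => h (j + 1) (by omega)) k (by omega),
        h1, h2]

theorem gdH_bwd {m : ℕ} (n : ℕ) : ∀ x y : ℕ → Fin (m + 2), (∀ k < n + 1, gdH k x = gdH k y) →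
    ∀ k < n, x k = y k := by
  induction n with
  | zero => intro x y _ k hk; omega
  | succ n ih =>
    intro x y h
    have h0 := h 0 (by omega)
    have h1 := h 1 (by omega)
    have e0 : x 0 = y 0 := by
      have hl : ∀ z : ℕ → Fin (m+2), z 0 ≠ 0 → gdH 0 z = 0 → z 0 = Fin.last (m + 1) := by
        intro z hz h
        simp only [gdH, if_neg hz] at h
        by_contra h'
        have := Fin.val_add_one_of_lt (lt_of_le_of_ne (Fin.le_last _) h')
        rw [h] at this; simp at this
      have key : ∀ x y : ℕ → Fin (m+2), gdH 0 x = gdH 0 y → gdH 1 x = gdH 1 y → x 0 = 0 → y 0 = 0 := by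
        intro x y h0 h1 hx
        by_contra hy
        have hy' := hl y hy (by rw [← h0]; simp [gdH, hx])
        have : gdH 1 y = 1 := by
          simp [gdH, hy']
        rw [this] at h1
        simp only [gdH, if_pos hx] at h1
        exact gdH_ne_one (fun j => x (j + 1)) (by simpa [gdH] using h1)
      by_cases hx : x 0 = 0
      · rw [hx, key x y h0 h1 hx]
      · have hy : y 0 ≠ 0 := fun hy => hx (key y x h0.symm h1.symm hy)
        simpa [gdH, hx, hy] using h0
    intro k hk
    rcases k with _ | k
    · exact e0
    by_cases hx : x 0 = 0
    · have hy : y 0 = 0 := by rw [← e0, hx]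
      refine ih (fun j => x (j + 1)) (fun j => y (j + 1)) (fun j hj => ?_) k (by omega)
      have := h (j + 1) (by omega)
      simpa [gdH, hx, hy] using this
    · have hy : y 0 ≠ 0 := by rw [← e0]; exact hx
      by_cases hx' : x 0 = Fin.last (m + 1)
      · have hy' : y 0 = Fin.last (m + 1) := by rw [← e0, hx']
        have := h (k + 1 + 1) (by omega)
        simpa [gdH, hx', hy'] using this
      · have hy' : y 0 ≠ Fin.last (m + 1) := by rw [← e0]; exact hx'
        have := h (k + 1) (by omega)
        simpa [gdH, hx, hy, hx', hy'] using this

def gdHF {m w : ℕ} (x : Fin (w + 2) × (ℕ → Fin (m + 2))) : Fin (w + 1) × (ℕ → Fin (m + 2)) :=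
  (⟨x.1.1 - 1, by have := x.1.2; omega⟩,
    if x.1.1 = 0 then (fun k => gdH k x.2) else
    if x.1.1 = 1 then (fun k => if k = 0 then 1 else x.2 (k - 1)) else x.2)

theorem gdHF_fwd {m w : ℕ} (n : ℕ) (x y : Fin (w + 2) × (ℕ → Fin (m + 2)))
    (h : gdAgw (n + 1) x y) : gdAgw (n + 1) (gdHF x) (gdHF y) := by
  have h0 := h.1 (by omega)
  refine ⟨fun _ => by simp [gdHF, h0], ?_⟩
  simp only [gdHF, ← h0]
  split_ifs with h1 h2
  · exact gdH_fwd n _ _ h.2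
  · intro k hk
    rcases k with _ | k
    · rfl
    · simpa using h.2 k (by omega)
  · exact h.2

theorem gdHF_bwd {m w : ℕ} (n : ℕ) (x y : Fin (w + 2) × (ℕ → Fin (m + 2)))
    (h : gdAgw (n + 1) (gdHF x) (gdHF y)) : gdAgw n x y := by
  have h0 : x.1.1 - 1 = y.1.1 - 1 := congrArg Fin.val (h.1 (by omega))
  have hd : ∀ k < n + 1, _ := h.2
  simp only [gdHF] at hd
  have e : x.1.1 = y.1.1 := by
    have := hd 0 (by omega)
    by_cases hx : x.1.1 = 0
    · by_cases hy : y.1.1 = 1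
      · rw [if_pos hx, if_neg (by omega), if_pos hy] at this
        exact absurd this (gdH_ne_one _)
      · omega
    · by_cases hy : y.1.1 = 0
      · rw [if_neg hx, if_pos (by omega), if_pos hy] at this
        exact absurd this.symm (gdH_ne_one _)
      · omega
  refine ⟨fun _ => Fin.ext e, ?_⟩
  simp only [← e] at hd
  split_ifs at hd with h1 h2
  · exact gdH_bwd n _ _ hd
  · intro k hk
    simpa using hd (k + 1) (by omega)
  · exact fun k hk => hd k (by omega)

theorem gd_hotel_step {m w : ℕ} :
    GDCE (gdAgw (A := Fin (m + 2)) (w := w + 2)) (gdAgw (A := Fin (m + 2)) (w := w + 1)) := by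
  refine ⟨gdHF, ⟨?_, ?_⟩, 1, ?_⟩
  · intro x y h
    have : ∀ n, gdAgw n x y := fun n => gdHF_bwd n x y (by rw [h]; exact ⟨fun _ => rfl, fun _ _ => rfl⟩)
    exact Prod.ext ((this 1).1 (by omega)) (funext fun k => (this (k + 1)).2 k (by omega))
  · rintro ⟨⟨a, ha'⟩, y⟩
    by_cases ha : a = 0
    · subst ha
      by_cases hy : y 0 = 1
      · refine ⟨(⟨1, by omega⟩, fun k => y (k + 1)), ?_⟩
        refine Prod.ext rfl (funext fun k => ?_)
        rcases k with _ | k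
        · simp [gdHF, hy]
        · simp [gdHF]
      · refine ⟨(⟨0, by omega⟩, fun k => gdH' k y), ?_⟩
        refine Prod.ext rfl (funext fun k => ?_)
        simpa [gdHF] using gdH_H' k y hy
    · refine ⟨(⟨a + 1, by omega⟩, y), ?_⟩
      refine Prod.ext rfl ?_
      simp [gdHF, ha]
  · intro n x y
    refine ⟨fun h => ?_, fun h => gdHF_bwd n x y h⟩
    have := gdHF_fwd n x y h
    exact ⟨fun _ => this.1 (by omega), fun k hk => this.2 k (by omega)⟩

theorem gd_hotel {m : ℕ} (w : ℕ) :
    GDCE (gdAgw (A := Fin (m + 2)) (w := w + 1)) (gdAg (A := Fin (m + 2))) := by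
  induction w with
  | zero =>
    have hs : ∀ a b : Fin (0 + 1), a = b := fun a b => Fin.ext (by omega)
    refine ⟨fun x => x.2, ⟨?_, ?_⟩, 0, ?_⟩
    · intro x y h
      exact Prod.ext (hs _ _) h
    · intro y; exact ⟨(0, y), rfl⟩
    · intro n x y
      exact ⟨fun h => h.2, fun h => ⟨fun _ => hs _ _, h⟩⟩
  | succ w ih => exact gd_hotel_step.trans' ih


theorem gd_bilip_of_CE {X : Type*} [MetricSpace X] (K : Set X) (m : ℕ) (r : ℝ) (hr0 : 0 < r)
    (hr1 : r < 1) (D : ℝ) (hD : ∀ x y : X, dist x y ≤ D)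
    (h : GDCE (fun n (x y : K) => dist x y ≤ r ^ n) (gdAg (A := Fin m))) : BilipWithSymb K m r := by
  obtain ⟨f, hf, b, hb⟩ := h
  refine ⟨f, hf, max 1 D * (r ^ (b + 1))⁻¹, ?_, ?_⟩
  · have h1 : 1 ≤ (r ^ (b + 1))⁻¹ := (one_le_inv₀ (by positivity)).2 (pow_le_one₀ hr0.le hr1.le)
    nlinarith [le_max_left 1 D]
  · intro x y
    by_cases hxy : x = y
    · subst hxy; simp [symbDist]
    have hne : f x ≠ f y := fun h => hxy (hf.1 h)
    have hset : {k : ℕ | f x k ≠ f y k}.Nonempty := by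
      by_contra h
      rw [Set.not_nonempty_iff_eq_empty] at h
      apply hne
      funext k
      by_contra hk
      have : k ∈ {k : ℕ | f x k ≠ f y k} := hk
      rw [h] at this; exact this
    simp only [symbDist, if_neg hne]
    set N := sInf {k : ℕ | f x k ≠ f y k} with hN
    have hN1 : f x N ≠ f y N := Nat.sInf_mem hset
    have hN2 : gdAg N (f x) (f y) := fun k hk => by
      by_contra h
      exact absurd (Nat.sInf_le (s := {k : ℕ | f x k ≠ f y k}) h) (by omega)
    have hM : 1 ≤ max 1 D := le_max_left _ _
    have hMD : D ≤ max 1 D := le_max_right _ _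
    set M := max 1 D
    have hrb : 0 < r ^ (b + 1) := by positivity
    constructor
    · rw [inv_mul_le_iff₀ (by positivity)]
      by_cases hNb : b ≤ N
      · have h1 := (hb (N - b) x y).2 (by rwa [Nat.sub_add_cancel hNb])
        simp only at h1
        refine h1.trans ?_
        have : r ^ N = r ^ (N - b) * r ^ b := by rw [← pow_add, Nat.sub_add_cancel hNb]
        rw [this, pow_succ]
        have hb0 : 0 < r ^ b := by positivity
        have : M * (r ^ b * r)⁻¹ * (r ^ (N - b) * r ^ b) = r ^ (N - b) * (M / r) := by
          field_simp
        rw [this]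
        have : 1 ≤ M / r := by rw [le_div_iff₀ hr0]; linarith
        exact le_mul_of_one_le_right (by positivity) this
      · have h1 : dist x y ≤ M := (hD x y).trans hMD
        refine h1.trans ?_
        rw [mul_assoc]
        refine le_mul_of_one_le_right (by positivity) ?_
        rw [inv_mul_eq_div, le_div_iff₀ hrb, one_mul]
        exact pow_le_pow_of_le_one hr0.le hr1.le (by omega)
    · have h1 : ¬ dist x y ≤ r ^ (N + 1 + b) := fun h =>
        hN1 ((hb (N + 1) x y).1 h N (by omega))
      push Not at h1
      have : r ^ (N + 1 + b) = r ^ N * r ^ (b + 1) := by rw [← pow_add]; congr 1; omega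
      rw [this, ← lt_div_iff₀ hrb] at h1
      refine h1.le.trans ?_
      rw [div_eq_mul_inv, mul_comm, mul_assoc]
      exact le_mul_of_one_le_left (by positivity) hM

theorem gd_dig {I : Type*} [Fintype I] (wt s : I → ℕ) (w : ℕ) (A : Type*) [Fintype A] [Nonempty A]
    (hs : ∀ i, s i < w)
    (hsum : ∀ τ < w, ∑ i ∈ Finset.univ.filter (fun i => s i = τ), wt i = Fintype.card A) :
    ∃ dig : I → ℕ → A,
      (∀ i i' a a', s i = s i' → a < wt i → a' < wt i' → dig i a = dig i' a' → i = i' ∧ a = a') ∧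
      (∀ τ < w, ∀ d : A, ∃ i, ∃ a < wt i, s i = τ ∧ dig i a = d) := by
  have hcard : ∀ τ, τ < w → Nonempty ((Σ i : {i // s i = τ}, Fin (wt i.1)) ≃ A) := by
    intro τ hτ
    rw [← Fintype.card_eq, Fintype.card_sigma, ← hsum τ hτ]
    simp only [Fintype.card_fin]
    rw [Finset.sum_subtype (Finset.univ.filter (fun i => s i = τ)) (p := fun i => s i = τ)]
    intro x; simp
  let e : ∀ τ, τ < w → ((Σ i : {i // s i = τ}, Fin (wt i.1)) ≃ A) := fun τ h => (hcard τ h).some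
  let dig : I → ℕ → A := fun i a => if h : a < wt i then e (s i) (hs i) ⟨⟨i, rfl⟩, ⟨a, h⟩⟩ else
    Classical.arbitrary A
  have hdig : ∀ i a τ (hτ : τ < w) (hi : s i = τ) (ha : a < wt i),
      dig i a = e τ hτ ⟨⟨i, hi⟩, ⟨a, ha⟩⟩ := by
    intro i a τ hτ hi ha
    subst hi
    simp only [dig, dif_pos ha]
  refine ⟨dig, ?_, ?_⟩
  · intro i i' a a' h ha ha' hd
    rw [hdig i a _ (hs i) rfl ha, hdig i' a' _ (hs i) h.symm ha'] at hd
    have := (e _ (hs i)).injective hd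
    have h1 : i = i' := congrArg (fun z => z.1.1) this
    have h2 : a = a' := congrArg (fun z => z.2.1) this
    exact ⟨h1, h2⟩
  · intro τ hτ d
    obtain ⟨⟨⟨i, hi⟩, ⟨a, ha⟩⟩, h⟩ := (e τ hτ).surjective d
    exact ⟨i, a, ha, hi, by rw [hdig i a τ hτ hi ha, h]⟩

theorem gd_gap {X : Type*} [MetricSpace X] {J : Type*} [Finite J] (U V : J → Set X)
    (hU : ∀ j, IsCompact (U j)) (hV : ∀ j, IsCompact (V j)) :
    ∃ δ : ℝ, 0 < δ ∧ ∀ j, Disjoint (U j) (V j) → ∀ x ∈ U j, ∀ y ∈ V j, δ ≤ dist x y := by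
  have : ∀ j, ∃ δ : ℝ, 0 < δ ∧ (Disjoint (U j) (V j) → ∀ x ∈ U j, ∀ y ∈ V j, δ ≤ dist x y) := by
    intro j
    by_cases h : Disjoint (U j) (V j)
    · obtain ⟨ρ, hρ, h1⟩ := Metric.exists_pos_forall_lt_edist (hU j) (hV j).isClosed h
      refine ⟨ρ, hρ, fun _ x hx y hy => ?_⟩
      have := h1 x hx y hy
      rw [edist_nndist, ENNReal.coe_lt_coe] at this
      rw [← coe_nndist]; exact_mod_cast this.le
    · exact ⟨1, one_pos, fun h' => absurd h' h⟩
  choose δ hδ h using this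
  obtain ⟨B, hB⟩ := (Set.finite_range (fun j => (δ j)⁻¹)).bddAbove
  refine ⟨(max B 1)⁻¹, by positivity, fun j hj x hx y hy => le_trans ?_ (h j hj x hx y hy)⟩
  have : (δ j)⁻¹ ≤ max B 1 := (hB ⟨j, rfl⟩).trans (le_max_left _ _)
  exact inv_le_of_inv_le₀ (hδ j) this

theorem gd_machine {X : Type*} [MetricSpace X] {r : ℝ} (hr0 : 0 < r) (hr1 : r < 1)
    (D : ℝ) (hD : ∀ x y : X, dist x y ≤ D)
    {Q : Type} [Finite Q] (Y : Q → Set X) (hne : ∀ q, (Y q).Nonempty) (hcpt : ∀ q, IsCompact (Y q))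
    (wt ht : Q → ℕ) (c : ℕ) (hc : 0 < c) (A : Type) [Fintype A] [Nonempty A]
    (I : Q → Type) [∀ q, Fintype (I q)] (t : ∀ q, I q → Q) (φ : ∀ q, I q → X → X)
    (hsim : ∀ q i x y, r ^ ht (t q i) * dist (φ q i x) (φ q i y) = r ^ (ht q + c) * dist x y)
    (hun : ∀ q, Y q = ⋃ i, φ q i '' Y (t q i))
    (hdis : ∀ q i i', i ≠ i' → Disjoint (φ q i '' Y (t q i)) (φ q i' '' Y (t q i')))
    (s : ∀ q, I q → ℕ) (hs : ∀ q i, s q i < wt q)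
    (hsum : ∀ q, ∀ τ < wt q, ∑ i ∈ Finset.univ.filter (fun i => s q i = τ), wt (t q i) =
      Fintype.card A) (q0 : Q) :
    GDCE (fun n (x y : Y q0) => dist x y ≤ r ^ n) (gdAgc (A := A) (w := wt q0) c) := by
  have hdig := fun q => gd_dig (fun i => wt (t q i)) (s q) (wt q) A (hs q) (hsum q)
  choose dig dinj dsurj using hdig
  have hinj : ∀ q i x y, φ q i x = φ q i y → x = y := by
    intro q i x y h
    have h1 := hsim q i x y
    rw [h, dist_self, mul_zero] at h1
    have : 0 < r ^ (ht q + c) := by positivity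
    have h2 : dist x y = 0 := by
      rcases mul_eq_zero.1 h1.symm with h | h
      · exact absurd h this.ne'
      · exact h
    exact dist_eq_zero.1 h2
  have hcont : ∀ q i, Continuous (φ q i) := by
    intro q i
    have : LipschitzWith (Real.toNNReal (r ^ (ht q + c) / r ^ ht (t q i))) (φ q i) := by
      refine LipschitzWith.of_dist_le_mul fun x y => ?_
      rw [Real.coe_toNNReal _ (by positivity), div_mul_eq_mul_div, ← hsim,
        mul_div_cancel_left₀ _ (by positivity)]
    exact this.continuous
  obtain ⟨δ, hδ, hgap⟩ := gd_gap (J := Σ q, I q × I q)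
    (fun j => φ j.1 j.2.1 '' Y (t j.1 j.2.1)) (fun j => φ j.1 j.2.2 '' Y (t j.1 j.2.2))
    (fun j => (hcpt _).image (hcont _ _)) (fun j => (hcpt _).image (hcont _ _))
  have hex : ∀ z : (Σ q, Y q), ∃ i : I z.1, ∃ y : Y (t z.1 i), φ z.1 i y = z.2 := by
    rintro ⟨q, x, hx⟩
    rw [hun q] at hx
    obtain ⟨i, y, hy, h⟩ := Set.mem_iUnion.1 hx
    exact ⟨i, ⟨y, hy⟩, h⟩
  choose item tp htp using hex
  let tl : (Σ q, Y q) → (Σ q, Y q) := fun z => ⟨t z.1 (item z), tp z⟩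
  let f1 : (Σ q, Y q) → ℕ := fun z => s z.1 (item z)
  let f2 : (Σ q, Y q) → ℕ → A := fun z n => dig (tl^[n] z).1 (item (tl^[n] z)) (f1 (tl (tl^[n] z)))
  have f1lt : ∀ z, f1 z < wt z.1 := fun z => hs _ _
  have f2s : ∀ z n, f2 z (n + 1) = f2 (tl z) n := fun z n => rfl
  have f20 : ∀ z, f2 z 0 = dig z.1 (item z) (f1 (tl z)) := fun z => rfl
  have hmem : ∀ q i, ∀ y ∈ Y (t q i), φ q i y ∈ Y q := by
    intro q i y hy
    rw [hun q]; exact Set.mem_iUnion.2 ⟨i, y, hy, rfl⟩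
  have hitem : ∀ q i (y : Y (t q i)), item ⟨q, ⟨φ q i y, hmem q i y y.2⟩⟩ = i ∧
      tl ⟨q, ⟨φ q i y, hmem q i y y.2⟩⟩ = ⟨t q i, y⟩ := by
    intro q i y
    have key : ∀ i' (y' : Y (t q i')), φ q i' y' = φ q i y → i' = i ∧
        (⟨t q i', y'⟩ : Σ q, Y q) = ⟨t q i, y⟩ := by
      intro i' y' h
      have h1 : i' = i := by
        by_contra hne
        exact Set.disjoint_left.1 (hdis q i' i hne) ⟨y', y'.2, rfl⟩ ⟨y, y.2, h.symm⟩
      subst h1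
      have := Subtype.ext (hinj q i' _ _ h)
      exact ⟨rfl, by rw [this]⟩
    exact key _ _ (htp ⟨q, ⟨φ q i y, hmem q i y y.2⟩⟩)
  -- every point has a decomposition
  have hdec : ∀ q (x : Y q), ∃ i, ∃ y : Y (t q i), x = ⟨φ q i y, hmem q i y y.2⟩ := by
    intro q x
    exact ⟨item ⟨q, x⟩, tp ⟨q, x⟩, Subtype.ext (htp ⟨q, x⟩).symm⟩
  obtain ⟨H, hH⟩ := (Set.finite_range ht).bddAbove
  have hHq : ∀ q, ht q ≤ H := fun q => hH ⟨q, rfl⟩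
  have hD0 : 0 ≤ D := by
    obtain ⟨x, -⟩ := hne q0
    exact (dist_self x).symm.le.trans (hD x x)
  have claimA : ∀ n q (x y : Y q), f1 ⟨q, x⟩ = f1 ⟨q, y⟩ →
      (∀ k < n, f2 ⟨q, x⟩ k = f2 ⟨q, y⟩ k) → dist (x : X) y ≤ D / r ^ H * r ^ (c * n + ht q) := by
    intro n
    induction n with
    | zero =>
      intro q x y _ _
      refine (hD _ _).trans ?_
      rw [div_mul_eq_mul_div, le_div_iff₀ (by positivity)]
      exact mul_le_mul_of_nonneg_left
        (pow_le_pow_of_le_one hr0.le hr1.le (by have := hHq q; omega)) hD0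
    | succ n ih =>
      intro q x y h1 h2
      obtain ⟨i, x', rfl⟩ := hdec q x
      obtain ⟨j, y', rfl⟩ := hdec q y
      obtain ⟨hi, hti⟩ := hitem q i x'
      obtain ⟨hj, htj⟩ := hitem q j y'
      have h0 := h2 0 (by omega)
      rw [f20, f20, hti, htj, hi, hj] at h0
      simp only [f1] at h1
      rw [hi, hj] at h1
      obtain ⟨e1, e2⟩ := dinj q i j _ _ h1 (f1lt _) (f1lt _) h0
      subst e1
      have := ih _ x' y' e2 (fun k hk => by
        have := h2 (k + 1) (by omega)
        rwa [f2s, f2s, hti, htj] at this)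
      have hp : 0 < r ^ ht (t q i) := by positivity
      have h3 := hsim q i x' y'
      have h4 : r ^ (ht q + c) * dist (x' : X) y' ≤
          r ^ (ht q + c) * (D / r ^ H * r ^ (c * n + ht (t q i))) :=
        mul_le_mul_of_nonneg_left this (by positivity)
      rw [← h3] at h4
      refine le_of_mul_le_mul_left (h4.trans (le_of_eq ?_)) hp
      ring
  have claimB : ∀ n q (x y : Y q), dist (x : X) y < δ * r ^ (c * n + ht q) →
      f1 ⟨q, x⟩ = f1 ⟨q, y⟩ ∧ (∀ k < n, f2 ⟨q, x⟩ k = f2 ⟨q, y⟩ k) := by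
    intro n
    have same : ∀ q i j (x' : Y (t q i)) (y' : Y (t q j)), dist (φ q i x') (φ q j y') < δ → i = j := by
      intro q i j x' y' h
      by_contra hne
      have := hgap ⟨q, i, j⟩ (hdis q i j hne) _ ⟨x', x'.2, rfl⟩ _ ⟨y', y'.2, rfl⟩
      linarith
    have small : ∀ k, δ * r ^ k ≤ δ := fun k =>
      mul_le_of_le_one_right hδ.le (pow_le_one₀ hr0.le hr1.le)
    induction n with
    | zero =>
      intro q x y h
      obtain ⟨i, x', rfl⟩ := hdec q x
      obtain ⟨j, y', rfl⟩ := hdec q y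
      obtain rfl := same q i j x' y' (h.trans_le (small _))
      refine ⟨?_, fun k hk => by omega⟩
      simp only [f1]
      rw [(hitem q i x').1, (hitem q i y').1]
    | succ n ih =>
      intro q x y h
      obtain ⟨i, x', rfl⟩ := hdec q x
      obtain ⟨j, y', rfl⟩ := hdec q y
      obtain rfl := same q i j x' y' (h.trans_le (small _))
      obtain ⟨hi, hti⟩ := hitem q i x'
      obtain ⟨hj, htj⟩ := hitem q i y'
      have h3 := hsim q i x' y'
      obtain ⟨h4, h5⟩ := ih _ x' y' (by
        have hp : 0 < r ^ (ht q + c) := by positivity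
        refine lt_of_mul_lt_mul_left (a := r ^ (ht q + c)) ?_ hp.le
        rw [← h3]
        have hp' : 0 < r ^ ht (t q i) := by positivity
        refine (mul_lt_mul_of_pos_left h hp').trans_le (le_of_eq ?_)
        ring)
      refine ⟨?_, ?_⟩
      · simp only [f1]
        rw [hi, hj]
      · intro k hk
        rcases k with _ | k
        · rw [f20, f20, hti, htj, hi, hj, h4]
        · rw [f2s, f2s, hti, htj]
          exact h5 k (by omega)
  have claimS : ∀ n q, ∀ τ < wt q, ∀ σ : ℕ → A, ∃ x : Y q, f1 ⟨q, x⟩ = τ ∧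
      ∀ k < n, f2 ⟨q, x⟩ k = σ k := by
    intro n
    induction n with
    | zero =>
      intro q τ hτ σ
      obtain ⟨i, a, ha, hi, -⟩ := dsurj q τ hτ (σ 0)
      obtain ⟨y, hy⟩ := hne (t q i)
      refine ⟨⟨φ q i y, hmem q i y hy⟩, ?_, fun k hk => by omega⟩
      simp only [f1]
      rw [(hitem q i ⟨y, hy⟩).1, hi]
    | succ n ih =>
      intro q τ hτ σ
      obtain ⟨i, a, ha, hi, hd⟩ := dsurj q τ hτ (σ 0)
      obtain ⟨y, hy1, hy2⟩ := ih (t q i) a ha (fun k => σ (k + 1))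
      obtain ⟨h1, h2⟩ := hitem q i y
      refine ⟨⟨φ q i y, hmem q i y y.2⟩, ?_, fun k hk => ?_⟩
      · simp only [f1]
        rw [h1, hi]
      · rcases k with _ | k
        · rw [f20, h2, h1, hy1, hd]
        · rw [f2s, h2]; exact hy2 k (by omega)
  refine ⟨fun x => (⟨f1 ⟨q0, x⟩, f1lt _⟩, f2 ⟨q0, x⟩), ⟨?_, ?_⟩, ?_⟩
  · intro x y h
    simp only [Prod.mk.injEq, Fin.mk.injEq] at h
    have h1 := fun n => claimA n q0 x y h.1 (fun k _ => by rw [h.2])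
    have h2 : Filter.Tendsto (fun n : ℕ => D / r ^ H * r ^ (c * n + ht q0)) Filter.atTop (nhds 0) := by
      have : Filter.Tendsto (fun n : ℕ => r ^ (c * n + ht q0)) Filter.atTop (nhds 0) := by
        refine (tendsto_pow_atTop_nhds_zero_of_lt_one hr0.le hr1).comp ?_
        refine Filter.tendsto_atTop_mono (fun n => ?_) Filter.tendsto_id
        have : 1 * n ≤ c * n := Nat.mul_le_mul_right _ hc
        simp only [id]; omega
      simpa using this.const_mul (D / r ^ H)
    have h3 : dist (x : X) y ≤ 0 := ge_of_tendsto' h2 h1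
    exact Subtype.ext (dist_le_zero.1 h3)
  · rintro ⟨⟨τ, hτ⟩, σ⟩
    choose u hu1 hu2 using fun n => claimS n q0 τ hτ σ
    obtain ⟨x, hx, ψ, hψ, hlim⟩ := (hcpt q0).tendsto_subseq (fun n => (u n).2)
    have hn : ∀ n, f1 ⟨q0, ⟨x, hx⟩⟩ = τ ∧ ∀ k < n, f2 ⟨q0, ⟨x, hx⟩⟩ k = σ k := by
      intro n
      have hpos : 0 < δ * r ^ (c * n + ht q0) := by positivity
      have hev := (Metric.tendsto_nhds.1 hlim _ hpos).and (Filter.eventually_ge_atTop n)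
      obtain ⟨j, hj, hj'⟩ := hev.exists
      have := claimB n q0 (u (ψ j)) ⟨x, hx⟩ hj
      have hψj : n ≤ ψ j := hj'.trans (hψ.le_apply)
      exact ⟨by rw [← this.1, hu1], fun k hk => by rw [← this.2 k hk, hu2 _ k (by omega)]⟩
    refine ⟨⟨x, hx⟩, ?_⟩
    refine Prod.ext (Fin.ext (hn 0).1) (funext fun k => (hn (k + 1)).2 k (by omega))
  · have hδr : 0 < δ * r ^ (c + ht q0) := by positivity
    obtain ⟨b1, hb1⟩ := exists_pow_lt_of_lt_one hδr hr1
    have hDr : 0 < (D / r ^ H + 1)⁻¹ := by positivity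
    obtain ⟨b2, hb2⟩ := exists_pow_lt_of_lt_one hDr hr1
    refine ⟨b1 + b2 + c, fun n x y => ⟨fun h => ?_, fun h => ?_⟩⟩
    · have hN := Nat.div_add_mod n c
      have hN' := Nat.mod_lt n hc
      have hcN : c * (n / c + 1) = c * (n / c) + c := by ring
      obtain ⟨h1, h2⟩ := claimB (n / c + 1) q0 x y (by
        refine lt_of_le_of_lt (show dist (x : X) y ≤ r ^ (n + b1) from h.trans
          (pow_le_pow_of_le_one hr0.le hr1.le (by omega))) ?_
        calc r ^ (n + b1) = r ^ n * r ^ b1 := pow_add _ _ _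
          _ < r ^ n * (δ * r ^ (c + ht q0)) := mul_lt_mul_of_pos_left hb1 (by positivity)
          _ = δ * r ^ (n + (c + ht q0)) := by rw [pow_add r n]; ring
          _ ≤ _ := mul_le_mul_of_nonneg_left
            (pow_le_pow_of_le_one hr0.le hr1.le (by omega)) hδ.le)
      refine ⟨fun _ => Fin.ext h1, fun k hk => h2 k ?_⟩
      by_contra hk'
      have := Nat.mul_le_mul_left c (show n / c + 1 ≤ k by omega)
      omega
    · have hN := Nat.div_add_mod (n + (b1 + b2 + c)) c
      have hN' := Nat.mod_lt (n + (b1 + b2 + c)) hc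
      set N := (n + (b1 + b2 + c)) / c
      have h1 := claimA N q0 x y (congrArg Fin.val (h.1 (by omega))) (fun k hk => h.2 k (by
        have := Nat.mul_le_mul_left c (show k + 1 ≤ N by omega)
        have h3 : c * (k + 1) = c * k + c := by ring
        omega))
      refine h1.trans ?_
      have hE : 0 ≤ D / r ^ H := by positivity
      calc D / r ^ H * r ^ (c * N + ht q0) ≤ D / r ^ H * r ^ (n + b2) :=
            mul_le_mul_of_nonneg_left (pow_le_pow_of_le_one hr0.le hr1.le (by omega)) hE
        _ = (D / r ^ H * r ^ b2) * r ^ n := by rw [pow_add]; ring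
        _ ≤ 1 * r ^ n := by
            refine mul_le_mul_of_nonneg_right ?_ (by positivity)
            have : D / r ^ H * r ^ b2 ≤ D / r ^ H * (D / r ^ H + 1)⁻¹ :=
              mul_le_mul_of_nonneg_left hb2.le hE
            refine this.trans ?_
            rw [← div_eq_mul_inv, div_le_one (by positivity)]
            linarith
        _ = r ^ n := one_mul _


theorem gd_dirichlet {p : ℕ} (v : Fin p → ℝ) (ε : ℝ) (hε : 0 < ε) :
    ∃ N : ℕ, 0 < N ∧ ∃ n : Fin p → ℤ, ∀ i, |(N : ℝ) * v i - n i| < ε := by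
  have hcp : IsCompact (Set.univ.pi fun _ : Fin p => Set.Icc (0 : ℝ) 1) :=
    isCompact_univ_pi fun _ => isCompact_Icc
  obtain ⟨x, -, ψ, hψ, hlim⟩ := hcp.tendsto_subseq
    (x := fun (k : ℕ) (i : Fin p) => Int.fract ((k : ℝ) * v i))
    (fun k i _ => ⟨Int.fract_nonneg _, (Int.fract_lt_one _).le⟩)
  obtain ⟨J, hJ⟩ := Metric.cauchySeq_iff.1 hlim.cauchySeq ε hε
  have h1 := hJ (J + 1) (by omega) J le_rfl
  have hlt : ψ J < ψ (J + 1) := hψ (by omega)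
  refine ⟨ψ (J + 1) - ψ J, by omega,
    fun i => ⌊(ψ (J + 1) : ℝ) * v i⌋ - ⌊(ψ J : ℝ) * v i⌋, fun i => ?_⟩
  have h2 := (dist_le_pi_dist _ _ i).trans_lt h1
  simp only [Function.comp, Real.dist_eq, Int.fract] at h2
  rw [Nat.cast_sub hlt.le]
  push_cast
  have e : ((ψ (J + 1) : ℝ) - ψ J) * v i - ((⌊(ψ (J + 1) : ℝ) * v i⌋ : ℝ) - ⌊(ψ J : ℝ) * v i⌋) =
      (ψ (J + 1) * v i - ⌊(ψ (J + 1) : ℝ) * v i⌋) - (ψ J * v i - ⌊(ψ J : ℝ) * v i⌋) := by ring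
  rw [e]
  exact h2

theorem gd_intvec {p : ℕ} (i0 : Fin p) (a : Fin p → Fin p → ℕ) (m : ℕ) (v : Fin p → ℝ)
    (hv : ∀ i, 0 < v i) (h : ∀ i, ∑ j, (a i j : ℝ) * v j = (m : ℝ) * v i) :
    ∃ u : Fin p → ℕ, (∀ i, 0 < u i) ∧ (∀ i, ∑ j, a i j * u j = m * u i) ∧
      Finset.univ.gcd u = 1 := by
  have : Nonempty (Fin p) := ⟨i0⟩
  obtain ⟨i1, hi1⟩ := Finite.exists_min v
  set S : ℝ := 1 + m + ∑ i, ∑ j, (a i j : ℝ) with hS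
  have hS0 : 0 < S := by positivity
  obtain ⟨N, hN, n, hn⟩ := gd_dirichlet v (min (v i1) S⁻¹)
    (lt_min (hv _) (by positivity))
  have hpos : ∀ i, 0 < n i := by
    intro i
    have h1 := (abs_lt.1 ((hn i).trans_le (min_le_left _ _))).2
    have h2 : v i ≤ N * v i := le_mul_of_one_le_left (hv i).le (by exact_mod_cast hN)
    have h3 := hi1 i
    have : (0 : ℝ) < n i := by linarith
    exact_mod_cast this
  have heq : ∀ i, ∑ j, (a i j : ℤ) * n j = m * n i := by
    intro i
    have hb : ∀ j, |(n j : ℝ) - N * v j| ≤ S⁻¹ := fun j => by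
      rw [abs_sub_comm]; exact ((hn j).trans_le (min_le_right _ _)).le
    have e1 : (∑ j, (a i j : ℝ) * n j) - m * n i =
        ∑ j, (a i j : ℝ) * (n j - N * v j) - m * (n i - N * v i) := by
      have : ∑ j, (a i j : ℝ) * (n j - N * v j) =
          ∑ j, (a i j : ℝ) * n j - N * ∑ j, (a i j : ℝ) * v j := by
        rw [Finset.mul_sum, ← Finset.sum_sub_distrib]
        exact Finset.sum_congr rfl fun j _ => by ring
      rw [this, h i]; ring
    have e2 : |(∑ j, (a i j : ℝ) * n j) - m * n i| < 1 := by
      rw [e1]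
      calc _ ≤ |∑ j, (a i j : ℝ) * (n j - N * v j)| + |m * (n i - N * v i)| := abs_sub _ _
        _ ≤ ∑ j, (a i j : ℝ) * S⁻¹ + m * S⁻¹ := by
            refine add_le_add ((Finset.abs_sum_le_sum_abs _ _).trans
              (Finset.sum_le_sum fun j _ => ?_)) ?_
            · rw [abs_mul, Nat.abs_cast]
              exact mul_le_mul_of_nonneg_left (hb j) (by positivity)
            · rw [abs_mul, Nat.abs_cast]
              exact mul_le_mul_of_nonneg_left (hb i) (by positivity)
        _ = (∑ j, (a i j : ℝ) + m) * S⁻¹ := by rw [← Finset.sum_mul]; ring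
        _ < 1 := by
            rw [← div_eq_mul_inv, div_lt_one hS0, hS]
            have : ∑ j, (a i j : ℝ) ≤ ∑ i, ∑ j, (a i j : ℝ) :=
              Finset.single_le_sum (f := fun i => ∑ j, (a i j : ℝ))
                (fun _ _ => by positivity) (Finset.mem_univ i)
            linarith
    have e3 : |(∑ j, (a i j : ℤ) * n j) - m * n i| < 1 := by exact_mod_cast e2
    have := Int.abs_lt_one_iff.1 e3
    linarith
  have heq' : ∀ i, ∑ j, a i j * (n j).toNat = m * (n i).toNat := by
    intro i
    zify
    rw [Int.toNat_of_nonneg (hpos i).le, ← heq i]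
    exact Finset.sum_congr rfl fun j _ => by rw [Int.toNat_of_nonneg (hpos j).le]
  obtain ⟨u, hu1, hu2⟩ := Finset.extract_gcd (fun i => (n i).toNat) (s := Finset.univ)
    ⟨i0, Finset.mem_univ _⟩
  set g := Finset.univ.gcd (fun i => (n i).toNat)
  have hnp : ∀ i, 0 < (n i).toNat := fun i => by have := hpos i; omega
  have hg : 0 < g := by
    rcases Nat.eq_zero_or_pos g with h0 | h0
    · have := hu1 i0 (Finset.mem_univ _)
      rw [h0, zero_mul] at this
      have := hnp i0
      omega
    · exact h0
  refine ⟨u, ?_, ?_, hu2⟩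
  · intro i
    rcases Nat.eq_zero_or_pos (u i) with h0 | h0
    · have h1 := hu1 i (Finset.mem_univ _)
      rw [h0, mul_zero] at h1
      have := hnp i
      omega
    · exact h0
  · intro i
    have := heq' i
    simp only [hu1 _ (Finset.mem_univ _)] at this
    refine Nat.eq_of_mul_eq_mul_left hg ?_
    rw [Finset.mul_sum]
    calc _ = ∑ j, a i j * (g * u j) := Finset.sum_congr rfl fun j _ => by ring
      _ = _ := by rw [this]; ring

theorem gd_frob (W : Finset ℕ) : ∃ F, ∀ n ≥ F, Nat.setGcd (W : Set ℕ) ∣ n →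
    ∃ c : ℕ → ℕ, ∑ u ∈ W, c u * u = n := by
  obtain ⟨F, hF⟩ := Nat.exists_mem_closure_of_ge (W : Set ℕ)
  refine ⟨F, fun n hn hd => ?_⟩
  have h := hF n hn hd
  rw [← Submodule.span_nat_eq_addSubmonoidClosure] at h
  obtain ⟨f, -, hf⟩ := Submodule.mem_span_finset.1 h
  exact ⟨f, by simpa using hf⟩

def GDIsCut {X : Type*} [MetricSpace X] {p : ℕ} {r : ℝ} (G : GraphDirected X p r) (j : Fin p)
    {I : Type} (k : I → Fin p) (n : I → ℕ) (φ : I → X → X) : Prop :=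
  (∀ i x y, dist (φ i x) (φ i y) = r ^ n i * dist x y) ∧ G.K j = ⋃ i, φ i '' G.K (k i) ∧
    ∀ i i', i ≠ i' → Disjoint (φ i '' G.K (k i)) (φ i' '' G.K (k i'))

theorem GDIsCut.refine' {X : Type*} [MetricSpace X] {p : ℕ} {r : ℝ} (hr : 0 < r)
    {G : GraphDirected X p r} {j : Fin p}
    {I : Type} {k : I → Fin p} {n : I → ℕ} {φ : I → X → X} (h : GDIsCut G j k n φ)
    {J : I → Type} {k' : ∀ i, J i → Fin p} {n' : ∀ i, J i → ℕ} {φ' : ∀ i, J i → X → X}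
    (h' : ∀ i, GDIsCut G (k i) (k' i) (n' i) (φ' i)) :
    GDIsCut G j (I := Σ i, J i) (fun z => k' z.1 z.2) (fun z => n z.1 + n' z.1 z.2)
      (fun z => φ z.1 ∘ φ' z.1 z.2) := by
  obtain ⟨h1, h2, h3⟩ := h
  have hinj : ∀ i, Function.Injective (φ i) := by
    intro i x y hxy
    have := h1 i x y
    rw [hxy, dist_self] at this
    have hp : 0 < r ^ n i := by positivity
    rcases mul_eq_zero.1 this.symm with h | h
    · exact absurd h hp.ne'
    · exact dist_eq_zero.1 h
  have hsub : ∀ z : Σ i, J i, φ z.1 ∘ φ' z.1 z.2 '' G.K (k' z.1 z.2) ⊆ φ z.1 '' G.K (k z.1) := by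
    rintro ⟨i, z⟩
    rw [Set.image_comp]
    refine Set.image_mono ?_
    rw [(h' i).2.1]
    exact Set.subset_iUnion (fun z => φ' i z '' G.K (k' i z)) z
  refine ⟨?_, ?_, ?_⟩
  · intro z x y
    simp only [Function.comp]
    rw [h1, (h' z.1).1, pow_add, mul_assoc]
  · ext x
    constructor
    · intro hx
      rw [h2] at hx
      obtain ⟨i, y, hy, rfl⟩ := Set.mem_iUnion.1 hx
      rw [(h' i).2.1] at hy
      obtain ⟨z, y2, hy2, rfl⟩ := Set.mem_iUnion.1 hy
      exact Set.mem_iUnion.2 ⟨⟨i, z⟩, y2, hy2, rfl⟩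
    · intro hx
      obtain ⟨z, hx⟩ := Set.mem_iUnion.1 hx
      rw [h2]
      exact Set.mem_iUnion.2 ⟨z.1, hsub z hx⟩
  · rintro ⟨i, z⟩ ⟨i', z'⟩ hne
    by_cases hi : i = i'
    · subst hi
      have hz : z ≠ z' := fun h => hne (by rw [h])
      simp only [Set.image_comp]
      exact (Set.disjoint_image_iff (hinj i)).2 ((h' i).2.2 z z' hz)
    · exact (h3 i i' hi).mono (hsub ⟨i, z⟩) (hsub ⟨i', z'⟩)

theorem gd_level {X : Type*} [MetricSpace X] {p : ℕ} {r : ℝ} (hr : 0 < r)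
    (G : GraphDirected X p r) (m : ℕ) (u : Fin p → ℕ)
    (hu : ∀ i, ∑ j, G.a i j * u j = m * u i)
    (A : Matrix (Fin p) (Fin p) ℝ) (hA : ∀ i j, A i j = (G.a i j : ℝ)) (n : ℕ) :
    ∀ j, ∃ (I : Type) (_ : Fintype I) (k : I → Fin p) (φ : I → X → X),
      GDIsCut G j k (fun _ => n) φ ∧ ∑ i, u (k i) = m ^ n * u j ∧
      ∀ l, 0 < (A ^ n) j l → ∃ i, k i = l := by
  induction n with
  | zero =>
    intro j
    refine ⟨Unit, inferInstance, fun _ => j, fun _ => id, ⟨by simp, by simp [Set.iUnion_const], ?_⟩,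
      by simp, ?_⟩
    · intro i i' h; exact absurd rfl h
    · intro l hl
      refine ⟨(), ?_⟩
      by_contra hne
      rw [pow_zero, Matrix.one_apply_ne hne] at hl
      exact lt_irrefl _ hl
  | succ n ih =>
    intro j
    choose I hI k φ hcut hsum hpos using ih
    have hedge : GDIsCut G j (I := Σ l, Fin (G.a j l)) (fun e => e.1) (fun _ => 1)
        (fun e => G.S j e.1 e.2) := by
      refine ⟨fun i x y => by rw [G.sim, pow_one], ?_, fun i i' h => G.disj j i.1 i'.1 i.2 i'.2 h⟩
      conv_lhs => rw [G.union j]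
      rw [Set.iUnion_sigma]
    have hc := hedge.refine' hr (fun e => hcut e.1)
    refine ⟨Σ e : (Σ l, Fin (G.a j l)), I e.1, inferInstance, _, _,
      (by simpa only [add_comm] using hc), ?_, ?_⟩
    · rw [Fintype.sum_sigma]
      simp only [hsum]
      rw [Fintype.sum_sigma]
      simp only [Finset.sum_const, Finset.card_univ, Fintype.card_fin, smul_eq_mul]
      calc _ = m ^ n * ∑ l, G.a j l * u l := by
            rw [Finset.mul_sum]; exact Finset.sum_congr rfl fun l _ => by ring
        _ = _ := by rw [hu, pow_succ]; ring
    · intro l hl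
      rw [pow_succ', Matrix.mul_apply] at hl
      obtain ⟨i, hi⟩ : ∃ i, 0 < A j i * (A ^ n) i l := by
        by_contra hcon
        push Not at hcon
        exact absurd hl (not_lt.2 (Finset.sum_nonpos fun i _ => hcon i))
      have hA0 : 0 ≤ A j i := by rw [hA]; positivity
      have hAp : 0 < A j i := lt_of_le_of_ne hA0 (fun h => by rw [← h, zero_mul] at hi; exact lt_irrefl _ hi)
      have hAn : 0 < (A ^ n) i l := (mul_pos_iff_of_pos_left hAp).1 hi
      rw [hA] at hAp
      have hap : 0 < G.a j i := by exact_mod_cast hAp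
      obtain ⟨z, hz⟩ := hpos i l hAn
      exact ⟨⟨⟨i, ⟨0, hap⟩⟩, z⟩, hz⟩

theorem gd_mixed {X : Type*} [MetricSpace X] {p : ℕ} {r : ℝ} (hr : 0 < r)
    (G : GraphDirected X p r) (m : ℕ) (hm : 2 ≤ m) (u : Fin p → ℕ) (hu0 : ∀ i, 0 < u i)
    (hu : ∀ i, ∑ j, G.a i j * u j = m * u i) (hgcd : Finset.univ.gcd u = 1)
    (A : Matrix (Fin p) (Fin p) ℝ) (hA : ∀ i j, A i j = (G.a i j : ℝ))
    (hirr : ∀ i j : Fin p, ∃ k : ℕ, 0 < k ∧ 0 < (A ^ k) i j) :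
    ∃ E c : ℕ, 0 < c ∧ E ≤ c ∧ ∀ j, ∀ e ≤ E, ∃ (I : Type) (_ : Fintype I) (k : I → Fin p)
      (d : I → ℕ) (φ : I → X → X) (s : I → ℕ), (∀ i, d i ≤ E) ∧
      GDIsCut G j k (fun i => e + c - d i) φ ∧ (∀ i, s i < u j * m ^ e) ∧
      ∀ τ < u j * m ^ e, ∑ i ∈ Finset.univ.filter (fun i => s i = τ), u (k i) * m ^ d i = m ^ c := by
  choose LI hLI lk lφ lcut lsum lpos using gd_level hr G m u hu A hA
  choose ℓ _ hℓ using hirr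
  have hm0 : 0 < m := by omega
  obtain ⟨E, hE⟩ : ∃ E, ∀ i j, ℓ i j ≤ E := by
    refine ⟨∑ i, ∑ j, ℓ i j, fun i j => ?_⟩
    exact (Finset.single_le_sum (f := fun j => ℓ i j) (fun _ _ => Nat.zero_le _)
      (Finset.mem_univ j)).trans (Finset.single_le_sum (f := fun i => ∑ j, ℓ i j)
      (fun _ _ => Nat.zero_le _) (Finset.mem_univ i))
  let W : Fin p → Finset ℕ := fun k0 => (Finset.range (E + 1)).biUnion fun d =>
    Finset.univ.image (fun i : LI d k0 => u (lk d k0 i) * m ^ (E - d))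
  have hWmem : ∀ k0 x, x ∈ W k0 ↔ ∃ d ≤ E, ∃ i : LI d k0, u (lk d k0 i) * m ^ (E - d) = x := by
    intro k0 x
    simp [W, Nat.lt_succ_iff]
  let g : Fin p → ℕ := fun k0 => Nat.setGcd (W k0 : Set ℕ)
  have hgW : ∀ k0, ∀ x ∈ W k0, g k0 ∣ x := fun k0 x hx => Nat.setGcd_dvd_of_mem hx
  have hgu : ∀ k0 l, g k0 ∣ u l * m ^ E := by
    intro k0 l
    obtain ⟨i, hi⟩ := lpos (ℓ k0 l) k0 l (hℓ k0 l)
    have h1 := hgW k0 (u l * m ^ (E - ℓ k0 l)) ((hWmem _ _).2 ⟨_, hE _ _, i, by rw [hi]⟩)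
    exact h1.trans (Nat.mul_dvd_mul_left _ (pow_dvd_pow _ (Nat.sub_le _ _)))
  have hgm : ∀ k0, g k0 ∣ m ^ E := by
    intro k0
    have h1 : g k0 ∣ Finset.univ.gcd (fun l => u l * m ^ E) :=
      Finset.dvd_gcd fun l _ => hgu k0 l
    rw [Finset.gcd_mul_right, hgcd] at h1
    simpa using h1
  choose F' hF' using fun k0 => gd_frob (W k0)
  let F := ∑ k0, F' k0
  have hF : ∀ k0, ∀ n ≥ F, g k0 ∣ n → ∃ c : ℕ → ℕ, ∑ x ∈ W k0, c x * x = n := fun k0 n hn =>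
    hF' k0 n ((Finset.single_le_sum (f := F') (fun _ _ => Nat.zero_le _)
      (Finset.mem_univ k0)).trans hn)
  let U := ∑ l, u l
  have hU : ∀ l, u l ≤ U := fun l => Finset.single_le_sum (f := u) (fun _ _ => Nat.zero_le _)
      (Finset.mem_univ l)
  let M := U * m ^ E
  have hM : ∀ l, ∀ e ≤ E, u l * m ^ e ≤ M := fun l e he =>
    Nat.mul_le_mul (hU l) (Nat.pow_le_pow_right hm0 he)
  let R := M * (F + M)
  let L0 := p * (R * (E + 1)) * U
  let c := E + L0 + (2 * (M * (F + M) * M)) + F + 1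
  have hcm : c < m ^ c := Nat.lt_pow_self (by omega)
  refine ⟨E, c, by omega, by omega, fun j e he => ?_⟩
  let L := e + c - E
  have hL : L0 ≤ L := by omega
  -- pigeonhole
  obtain ⟨k0, hk0⟩ : ∃ k0, R * (E + 1) ≤
      (Finset.univ.filter (fun i : LI L j => lk L j i = k0)).card := by
    by_contra hcon
    push Not at hcon
    have h1 : m ^ L * u j ≤ Fintype.card (LI L j) * U := by
      rw [← lsum L j]
      refine (Finset.sum_le_card_nsmul _ _ U (fun i _ => hU _)).trans ?_
      simp
    have h2 : Fintype.card (LI L j) ≤ p * (R * (E + 1)) := by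
      rw [← Finset.card_univ, Finset.card_eq_sum_card_fiberwise (f := lk L j) (t := Finset.univ)
        (fun _ _ => Finset.mem_coe.2 (Finset.mem_univ _))]
      refine (Finset.sum_le_card_nsmul _ _ (R * (E + 1)) (fun i _ => (hcon i).le)).trans ?_
      simp
    have h3 : m ^ L ≤ L0 := calc
      m ^ L ≤ m ^ L * u j := Nat.le_mul_of_pos_right _ (hu0 j)
      _ ≤ _ := h1
      _ ≤ L0 := Nat.mul_le_mul_right _ h2
    have h4 : L < m ^ L := Nat.lt_pow_self (by omega)
    omega
  obtain ⟨h⟩ : Nonempty ((Fin R × Fin (E + 1)) ↪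
      {i : LI L j // i ∈ Finset.univ.filter (fun i : LI L j => lk L j i = k0)}) := by
    refine Function.Embedding.nonempty_of_card_le ?_
    rw [Fintype.card_prod, Fintype.card_fin, Fintype.card_fin, Fintype.card_coe]
    exact hk0
  have hhk : ∀ x, lk L j (h x).1 = k0 := fun x => (Finset.mem_filter.1 (h x).2).2
  let dep : LI L j → ℕ := fun i => if hx : ∃ x, (h x).1 = i then (hx.choose).2.1 else 0
  have hdep1 : ∀ x, dep (h x).1 = x.2.1 := by
    intro x
    have hx : ∃ y, (h y).1 = (h x).1 := ⟨x, rfl⟩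
    simp only [dep, dif_pos hx]
    have := h.injective (Subtype.ext hx.choose_spec)
    rw [this]
  have hdepE : ∀ i, dep i ≤ E := by
    intro i
    simp only [dep]
    split_ifs with hx
    · have := hx.choose.2.2; omega
    · omega
  have hdep0 : ∀ i, dep i ≠ 0 → lk L j i = k0 := by
    intro i hi
    simp only [dep] at hi
    split_ifs at hi with hx
    · obtain ⟨x, rfl⟩ := hx
      exact hhk x
    · exact absurd rfl hi
  have hcut := (lcut L j).refine' hr (fun i => lcut (dep i) (lk L j i))
  let I := Σ i : LI L j, LI (dep i) (lk L j i)
  let w : I → ℕ := fun z => u (lk (dep z.1) (lk L j z.1) z.2) * m ^ (E - dep z.1)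
  have hwW : ∀ z : I, lk L j z.1 = k0 → w z ∈ W k0 := by
    rintro ⟨i, z⟩ hi
    rw [hWmem]
    have key : ∀ k' (hk : k' = k0) (d : ℕ), d ≤ E → ∀ z : LI d k',
        ∃ d' ≤ E, ∃ i : LI d' k0, u (lk d' k0 i) * m ^ (E - d') = u (lk d k' z) * m ^ (E - d) := by
      rintro k' rfl d hd z
      exact ⟨d, hd, z, rfl⟩
    exact key _ hi _ (hdepE i) z
  have hq : 0 < u j * m ^ e := Nat.mul_pos (hu0 j) (by positivity)
  obtain ⟨q, hqq⟩ : ∃ q, u j * m ^ e = q + 1 := ⟨u j * m ^ e - 1, by omega⟩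
  obtain ⟨s, hs1, hs2⟩ := gd_part w (W k0) M F (m ^ c) (g k0)
    (by
      intro x hx
      obtain ⟨d, hd, i, rfl⟩ := (hWmem _ _).1 hx
      exact ⟨Nat.mul_pos (hu0 _) (by positivity), hM _ _ (Nat.sub_le _ _)⟩)
    (hF k0) ((hgm k0).trans (pow_dvd_pow _ (by omega))) (by omega) (by omega) q Finset.univ
    (by
      intro z _
      refine ⟨hM _ _ (Nat.sub_le _ _), ?_⟩
      by_cases hz : dep z.1 = 0
      · have : w z = u (lk (dep z.1) (lk L j z.1) z.2) * m ^ E := by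
          have h0 : E - dep z.1 = E := by omega
          show _ * m ^ (E - dep z.1) = _
          rw [h0]
        rw [this]
        exact hgu k0 _
      · exact hgW k0 _ (hwW z (hdep0 _ hz)))
    (by
      rw [Fintype.sum_sigma, ← hqq]
      have : ∀ i : LI L j, ∑ z : LI (dep i) (lk L j i), w ⟨i, z⟩ = m ^ E * u (lk L j i) := by
        intro i
        simp only [w]
        rw [← Finset.sum_mul, lsum]
        have : m ^ E = m ^ dep i * m ^ (E - dep i) := by
          rw [← pow_add, Nat.add_sub_cancel' (hdepE i)]
        rw [this]; ring
      simp only [this]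
      rw [← Finset.mul_sum, lsum]
      have : m ^ E * m ^ L = m ^ e * m ^ c := by
        rw [← pow_add, ← pow_add]; congr 1; omega
      rw [← mul_assoc, this]; ring)
    (by
      intro x hx
      obtain ⟨d, hd, i0, rfl⟩ := (hWmem _ _).1 hx
      have hRq : (q + 1) * (F + M) ≤ R := by
        rw [← hqq]
        exact Nat.mul_le_mul_right _ (hM j e he)
      refine hRq.trans ?_
      have key : ∀ k' d', k' = k0 → d' = d → ∃ z : LI d' k',
          u (lk d' k' z) * m ^ (E - d') = u (lk d k0 i0) * m ^ (E - d) := by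
        rintro k' d' rfl rfl
        exact ⟨i0, rfl⟩
      have hz : ∀ t : Fin R, ∃ z : LI (dep (h (t, ⟨d, by omega⟩)).1) (lk L j (h (t, ⟨d, by omega⟩)).1),
          w ⟨(h (t, ⟨d, by omega⟩)).1, z⟩ = u (lk d k0 i0) * m ^ (E - d) :=
        fun t => key _ _ (hhk _) (hdep1 _)
      choose z hz using hz
      have hc := Finset.card_le_card_of_injOn (s := (Finset.univ : Finset (Fin R)))
        (t := Finset.univ.filter (fun i : I => w i = u (lk d k0 i0) * m ^ (E - d)))
        (fun t => ⟨(h (t, ⟨d, by omega⟩)).1, z t⟩)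
        (fun t _ => by
          simp only [Finset.coe_filter, Finset.mem_univ, true_and, Set.mem_ofPred_eq]
          exact hz t)
        (by
          intro t _ t' _ htt
          have h1 : (h (t, ⟨d, by omega⟩)).1 = (h (t', ⟨d, by omega⟩)).1 := congrArg Sigma.fst htt
          have h2 := h.injective (Subtype.ext h1)
          exact congrArg Prod.fst h2)
      simpa using hc)
  refine ⟨I, inferInstance, fun z => lk (dep z.1) (lk L j z.1) z.2, fun z => E - dep z.1,
    fun z => lφ L j z.1 ∘ lφ (dep z.1) (lk L j z.1) z.2, s, fun z => Nat.sub_le _ _, ?_, ?_, ?_⟩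
  rotate_left
  · intro z; rw [hqq]; exact hs1 z (Finset.mem_univ z)
  · intro τ hτ
    rw [hqq] at hτ
    exact hs2 τ hτ
  · have hfun : (fun z : I => e + c - (E - dep z.1)) = (fun z : I => L + dep z.1) := by
      funext z
      have := hdepE z.1
      omega
    rw [hfun]
    exact hcut

/-- **Proposition (transitive case).** If `K_1, …, K_p` are dust-like
graph-directed sets with ratio `r ∈ (0,1)` and integer characteristic `m ≥ 2`,
and the adjacency matrix `A` is irreducible (for all `i, j` there is `k ≥ 1`
with `(A^k)_{i,j} > 0`, i.e. the graph is transitive), then each `K_i` is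
bilipschitz equivalent to `Σ_m^r`. -/
theorem irreducible_graphDirected_bilip_symb
    {X : Type*} [MetricSpace X] [CompactSpace X] {p : ℕ} {r : ℝ}
    (hr : r ∈ Set.Ioo (0 : ℝ) 1) {m : ℕ} (hm : 2 ≤ m)
    (G : GraphDirected X p r) (hG : G.HasCharacteristic m)
    (A : Matrix (Fin p) (Fin p) ℝ) (hA : ∀ i j, A i j = (G.a i j : ℝ))
    (hirr : ∀ i j : Fin p, ∃ k : ℕ, 0 < k ∧ 0 < (A ^ k) i j) :
    ∀ i : Fin p, BilipWithSymb (G.K i) m r := by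
  intro i
  obtain ⟨v, hv, h⟩ := hG
  obtain ⟨u, hu0, hu, hgcd⟩ := gd_intvec i G.a m v hv h
  obtain ⟨E, c, hc, hEc, H⟩ := gd_mixed hr.1 G m hm u hu0 hu hgcd A hA hirr
  choose I hI k d φ s hd hcut hs hsum using
    (fun q : Fin p × Fin (E + 1) => H q.1 q.2.1 (Nat.lt_succ_iff.1 q.2.2))
  obtain ⟨D, hD⟩ : ∃ D : ℝ, ∀ x y : X, dist x y ≤ D :=
    ⟨Metric.diam (Set.univ : Set X), fun x y =>
      Metric.dist_le_diam_of_mem isCompact_univ.isBounded (Set.mem_univ x) (Set.mem_univ y)⟩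
  have : Nonempty (Fin c → Fin m) := ⟨fun _ => ⟨0, by omega⟩⟩
  have M := gd_machine hr.1 hr.2 D hD (fun q : Fin p × Fin (E + 1) => G.K q.1)
    (fun q => G.nonempty _) (fun q => G.compact _) (fun q => u q.1 * m ^ q.2.1) (fun q => q.2.1)
    c hc (Fin c → Fin m) I (fun q z => (k q z, ⟨d q z, Nat.lt_succ_iff.2 (hd q z)⟩)) φ
    (by
      intro q z x y
      have hdz := hd q z
      rw [(hcut q).1 z x y, ← mul_assoc, ← pow_add]
      congr 2
      show d q z + (q.2.1 + c - d q z) = q.2.1 + c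
      omega)
    (fun q => (hcut q).2.1) (fun q => (hcut q).2.2) s hs
    (fun q τ hτ => by
      rw [Fintype.card_fun, Fintype.card_fin, Fintype.card_fin]
      exact hsum q τ hτ) (i, 0)
  refine gd_bilip_of_CE _ m r hr.1 hr.2 D hD (M.trans' ((gd_flat hc).trans' ?_))
  obtain ⟨m', rfl⟩ : ∃ m', m = m' + 2 := ⟨m - 2, by omega⟩
  have hw : 0 < u i * (m' + 2) ^ ((0 : Fin (E + 1)) : ℕ) := Nat.mul_pos (hu0 i) (by positivity)
  obtain ⟨w, hw'⟩ : ∃ w, u i * (m' + 2) ^ ((0 : Fin (E + 1)) : ℕ) = w + 1 :=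
    ⟨u i * (m' + 2) ^ ((0 : Fin (E + 1)) : ℕ) - 1, by omega⟩
  have hh := gd_hotel (m := m') w
  rw [← hw'] at hh
  exact hh
end

section
/- Let {K_1, …, K_s, K_{s+1}, …, K_{s+t}} be dust-like graph-directed sets with ratio r ∈ (0,1) and integer characteristic m ≥ 2 whose adjacency matrix has the block upper triangular form [[D, C],[O, B]], where D is an irreducible s×s block, B is t×t, and C ≠ 0. If K_{s+1}, …, K_{s+t} are each bilipschitz equivalent to Σ_m^r, then K_i is bilipschitz equivalent to Σ_m^r for every 1 ≤ i ≤ s. -/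
open scoped Classical

def agr {α : Type*} (j : ℕ) (x y : ℕ → α) : Prop := ∀ l, l < j → x l = y l

lemma symb_le_iff {r : ℝ} (h0 : 0 < r) (h1 : r < 1) {m : ℕ} (x y : ℕ → Fin m) (j : ℕ) :
    symbDist r x y ≤ r ^ j ↔ agr j x y := by
  unfold symbDist
  split_ifs with h
  · subst h
    exact ⟨fun _ l _ => rfl, fun _ => by positivity⟩
  · have hne : {k : ℕ | x k ≠ y k}.Nonempty := Function.ne_iff.mp h
    rw [pow_le_pow_iff_right_of_lt_one₀ h0 h1]
    constructor
    · intro hj l hl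
      by_contra hc
      have := Nat.sInf_le (s := {k : ℕ | x k ≠ y k}) hc
      omega
    · intro ha
      by_contra hc
      exact Nat.sInf_mem hne (ha _ (by omega))

lemma symb_cases {r : ℝ} {m : ℕ} (x y : ℕ → Fin m) :
    symbDist r x y = 0 ∧ x = y ∨ ∃ k, symbDist r x y = r ^ k ∧ agr k x y ∧ x k ≠ y k := by
  unfold symbDist
  split_ifs with h
  · exact Or.inl ⟨rfl, h⟩
  · have hne : {k : ℕ | x k ≠ y k}.Nonempty := Function.ne_iff.mp h
    refine Or.inr ⟨_, rfl, ?_, Nat.sInf_mem hne⟩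
    intro l hl
    by_contra hc
    have := Nat.sInf_le (s := {k : ℕ | x k ≠ y k}) hc
    omega

lemma symb_nonneg {r : ℝ} (h0 : 0 < r) {m : ℕ} (x y : ℕ → Fin m) : 0 ≤ symbDist r x y := by
  unfold symbDist
  split_ifs <;> positivity

lemma symb_le_one {r : ℝ} (h0 : 0 < r) (h1 : r < 1) {m : ℕ} (x y : ℕ → Fin m) :
    symbDist r x y ≤ 1 := by
  have := (symb_le_iff h0 h1 x y 0).2 (fun l hl => by omega)
  simpa using this

lemma symb_comm {r : ℝ} {m : ℕ} (x y : ℕ → Fin m) : symbDist r x y = symbDist r y x := by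
  unfold symbDist
  simp only [eq_comm, ne_comm]

lemma symb_self {r : ℝ} {m : ℕ} (x : ℕ → Fin m) : symbDist r x x = 0 := by simp [symbDist]

lemma symb_eq {r : ℝ} (h0 : 0 < r) {m : ℕ} {x y : ℕ → Fin m} (h : symbDist r x y ≤ 0) : x = y := by
  rcases symb_cases (r := r) x y with h' | ⟨k, hk, -⟩
  · exact h'.2
  · have := pow_pos h0 k
    linarith

lemma symb_one {r : ℝ} {m : ℕ} {x y : ℕ → Fin m} (h : x 0 ≠ y 0) : symbDist r x y = 1 := by
  rcases symb_cases (r := r) x y with h' | ⟨k, hk, ha, hn⟩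
  · exact absurd (congrFun h'.2 0) h
  · rcases Nat.eq_zero_or_pos k with rfl | hk0
    · simpa using hk
    · exact absurd (ha 0 hk0) h

/-- comparison of symbolic distances through agreement -/
lemma symb_compare {r : ℝ} (h0 : 0 < r) (h1 : r < 1) {m m' : ℕ} {x y : ℕ → Fin m}
    {x' y' : ℕ → Fin m'} (a : ℕ) (h : ∀ j, agr (j + a) x y → agr j x' y') :
    symbDist r x' y' ≤ (r ^ a)⁻¹ * symbDist r x y := by
  have ha : 0 < r ^ a := pow_pos h0 a
  rcases symb_cases (r := r) x y with h' | ⟨k, hk, hag, hn⟩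
  · obtain ⟨h2, rfl⟩ := h'
    have : x' = y' := by
      funext l
      exact h (l+1) (fun _ _ => rfl) l (by omega)
    rw [this, symb_self, h2]; simp
  · rw [hk]
    rcases le_total a k with hak | hak
    · obtain ⟨b, rfl⟩ := Nat.exists_eq_add_of_le hak
      have := (symb_le_iff h0 h1 x' y' b).2 (h b (by rwa [add_comm]))
      rw [pow_add, inv_mul_cancel_left₀ ha.ne']
      exact this
    · have h2 := symb_le_one h0 h1 x' y'
      have h3 : r ^ a ≤ r ^ k := pow_le_pow_of_le_one h0.le h1.le hak
      have h4 : 1 ≤ (r ^ a)⁻¹ * r ^ k := by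
        rw [inv_mul_eq_div, le_div_iff₀ ha]; simpa using h3
      linarith

def sh {α : Type*} (x : ℕ → α) : ℕ → α := fun n => x (n+1)

def cns {α : Type*} (a : α) (x : ℕ → α) : ℕ → α := fun n => Nat.casesOn n a x

@[simp] lemma sh_cns {α : Type*} (a : α) (x : ℕ → α) : sh (cns a x) = x := rfl
@[simp] lemma cns_zero {α : Type*} (a : α) (x : ℕ → α) : cns a x 0 = a := rfl
@[simp] lemma cns_succ {α : Type*} (a : α) (x : ℕ → α) (n : ℕ) : cns a x (n+1) = x n := rfl
lemma cns_sh {α : Type*} (x : ℕ → α) : cns (x 0) (sh x) = x := by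
  funext n; cases n <;> rfl

lemma symb_sh {r : ℝ} (h0 : 0 < r) (h1 : r < 1) {m : ℕ} {x y : ℕ → Fin m} (h : x 0 = y 0) :
    symbDist r x y = r * symbDist r (sh x) (sh y) := by
  apply le_antisymm
  · rcases symb_cases (r := r) (sh x) (sh y) with h' | ⟨k, hk, hag, hn⟩
    · have : x = y := by rw [← cns_sh x, ← cns_sh y, h, h'.2]
      rw [h'.1, this, symb_self]; simp
    · rw [hk, ← pow_succ', symb_le_iff h0 h1]
      intro l hl
      cases l with
      | zero => exact h
      | succ l => exact hag l (by omega)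
  · have := symb_compare h0 h1 (x := x) (y := y) (x' := sh x) (y' := sh y) 1
      (fun j hj l hl => hj (l+1) (by omega))
    rw [pow_one, inv_mul_eq_div, le_div_iff₀ h0] at this
    linarith

def Par {X : Type*} (d : X → X → ℝ) (m : ℕ) (r : ℝ) (K : Set X) : Prop :=
  ∃ g : (ℕ → Fin m) → X, Set.range g = K ∧ ∃ C : ℝ, 0 < C ∧ ∀ x y,
    symbDist r x y ≤ C * d (g x) (g y) ∧ d (g x) (g y) ≤ C * symbDist r x y

lemma Par.image {X : Type*} {d : X → X → ℝ} {m : ℕ} {r : ℝ} (h0 : 0 < r)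
    {K : Set X} (h : Par d m r K)
    (S : X → X) {q : ℝ} (hq : 0 < q) (hS : ∀ x y, d (S x) (S y) = q * d x y) :
    Par d m r (S '' K) := by
  obtain ⟨g, rfl, C, hC, hg⟩ := h
  refine ⟨S ∘ g, Set.range_comp _ _, C * q + C * q⁻¹, by positivity, fun x y => ?_⟩
  obtain ⟨h1, h2⟩ := hg x y
  simp only [Function.comp, hS]
  have hs := symb_nonneg h0 x y
  have hd : 0 ≤ d (g x) (g y) := by
    by_contra hc
    push Not at hc
    nlinarith
  constructor
  · have : (C * q + C * q⁻¹) * (q * d (g x) (g y)) = C * q * q * d (g x) (g y) + C * d (g x) (g y) := by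
      field_simp
    rw [this]
    have : 0 ≤ C * q * q * d (g x) (g y) := by positivity
    linarith
  · have h3 : q * d (g x) (g y) ≤ q * (C * symbDist r x y) := by gcongr
    have : 0 ≤ C * q⁻¹ * symbDist r x y := by positivity
    nlinarith

def fstOne {m : ℕ} (z : ℕ → Fin m) : Prop := ∃ k, (z k : ℕ) = 1 ∧ ∀ l, l < k → (z l : ℕ) = 0

lemma mixed_agr1 {m : ℕ} {z z' : ℕ → Fin m} (hz : fstOne z) (hz' : ¬ fstOne z') (j : ℕ)
    (h : agr (j+1) z z') : agr j (sh z) z' := by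
  obtain ⟨k, hk, hk0⟩ := hz
  have hkj : j + 1 ≤ k := by
    by_contra hc
    exact hz' ⟨k, by rw [← h k (by omega)]; exact hk,
      fun l hl => by rw [← h l (by omega)]; exact hk0 l hl⟩
  intro l hl
  have a1 := hk0 l (by omega)
  have a2 := h l (by omega)
  have a3 : (z (l+1) : ℕ) = 0 := hk0 (l+1) (by omega)
  rw [← a2]
  apply Fin.ext
  simp only [sh]
  omega

lemma mixed_agr2 {m : ℕ} {z z' : ℕ → Fin m} (hz : fstOne z) (hz' : ¬ fstOne z')
    (hz0 : (z 0 : ℕ) ≠ 1) (j : ℕ) (h : agr j (sh z) z') : agr j z z' := by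
  obtain ⟨k, hk, hk0⟩ := hz
  have hk1 : 1 ≤ k := by
    by_contra hc
    have : k = 0 := by omega
    subst this
    exact hz0 hk
  have hkj : j < k := by
    by_contra hc
    refine hz' ⟨k - 1, ?_, fun l hl => ?_⟩
    · rw [← h (k-1) (by omega)]; simp only [sh]; rw [Nat.sub_add_cancel hk1]; exact hk
    · rw [← h l (by omega)]; exact hk0 (l+1) (by omega)
  intro l hl
  have a1 := hk0 l (by omega)
  have a3 : (z (l+1) : ℕ) = 0 := hk0 (l+1) (by omega)
  rw [← h l hl]
  apply Fin.ext
  simp only [sh]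
  omega

noncomputable def squ {m : ℕ} (z : ℕ → Fin m) : ℕ → Fin m := if fstOne z then sh z else z

lemma squ_compare {r : ℝ} (h0 : 0 < r) (h1 : r < 1) {m : ℕ} {z z' : ℕ → Fin m}
    (hz : (z 0 : ℕ) ≠ 1) (hz' : (z' 0 : ℕ) ≠ 1) :
    symbDist r z z' ≤ symbDist r (squ z) (squ z') ∧
      symbDist r (squ z) (squ z') ≤ r⁻¹ * symbDist r z z' := by
  have key : ∀ z z' : ℕ → Fin m, (z 0 : ℕ) ≠ 1 → fstOne z → ¬ fstOne z' →
    symbDist r z z' ≤ symbDist r (sh z) z' ∧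
      symbDist r (sh z) z' ≤ r⁻¹ * symbDist r z z' := by
    intro z z' hz a b
    constructor
    · have := symb_compare h0 h1 (x := sh z) (y := z') (x' := z) (y' := z') 0
        (fun j hj => mixed_agr2 a b hz j hj)
      simpa using this
    · have := symb_compare h0 h1 (x := z) (y := z') (x' := sh z) (y' := z') 1
        (fun j hj => mixed_agr1 a b j hj)
      simpa using this
  have hr1 : 1 ≤ r⁻¹ := (one_le_inv₀ h0).2 h1.le
  unfold squ
  split_ifs with a b b
  · have e : z 0 = z' 0 := by
      obtain ⟨k, hk, hk0⟩ := a
      obtain ⟨k', hk', hk0'⟩ := b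
      have : k ≠ 0 := by rintro rfl; exact hz hk
      have : k' ≠ 0 := by rintro rfl; exact hz' hk'
      apply Fin.ext
      rw [hk0 0 (by omega), hk0' 0 (by omega)]
    rw [symb_sh h0 h1 e, inv_mul_cancel_left₀ h0.ne']
    have := symb_nonneg h0 (sh z) (sh z')
    exact ⟨by nlinarith, le_rfl⟩
  · exact key z z' hz a b
  · rw [symb_comm z z', symb_comm z (sh z')]
    exact key z' z hz' b a
  · have := symb_nonneg h0 z z'
    exact ⟨le_rfl, by nlinarith⟩

lemma Par.union {X : Type*} {d : X → X → ℝ} {m : ℕ} (hm : 2 ≤ m) {r : ℝ} (h0 : 0 < r) (h1 : r < 1)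
    {K K' : Set X} (h : Par d m r K) (h' : Par d m r K') {δ Δ : ℝ} (hδ : 0 < δ)
    (hdc : ∀ x y, d x y = d y x) (hΔ : ∀ x y, d x y ≤ Δ)
    (hsep : ∀ x ∈ K, ∀ y ∈ K', δ ≤ d x y) : Par d m r (K ∪ K') := by
  obtain ⟨g, rfl, C, hC, hg⟩ := h
  obtain ⟨g', rfl, C', hC', hg'⟩ := h'
  let one : Fin m := ⟨1, by omega⟩
  let zero : Fin m := ⟨0, by omega⟩
  have hr1 : 1 ≤ r⁻¹ := (one_le_inv₀ h0).2 h1.le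
  have hΔ0 : 0 ≤ Δ := by
    have := hΔ (g fun _ => one) (g' fun _ => one)
    have := hsep _ ⟨fun _ => one, rfl⟩ _ ⟨fun _ => one, rfl⟩
    linarith
  let f : (ℕ → Fin m) → X := fun z => if (z 0 : ℕ) = 1 then g' (sh z) else g (squ z)
  set B := C * r⁻¹ + C' * r⁻¹ + δ⁻¹ + Δ with hB
  have hB0 : 0 < B := by positivity
  have B1 : C * r⁻¹ ≤ B := by
    have : 0 < C' * r⁻¹ := by positivity
    have : 0 < δ⁻¹ := by positivity
    linarith
  have B2 : C' * r⁻¹ ≤ B := by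
    have : 0 < C * r⁻¹ := by positivity
    have : 0 < δ⁻¹ := by positivity
    linarith
  have B3 : δ⁻¹ ≤ B := by
    have : 0 < C * r⁻¹ := by positivity
    have : 0 < C' * r⁻¹ := by positivity
    linarith
  have B4 : Δ ≤ B := by
    have : 0 < C * r⁻¹ := by positivity
    have : 0 < C' * r⁻¹ := by positivity
    have : 0 < δ⁻¹ := by positivity
    linarith
  have B5 : C ≤ B := by nlinarith
  have B6 : C' ≤ B := by nlinarith
  have cross : ∀ a b : X, δ ≤ d a b → 1 ≤ B * d a b ∧ d a b ≤ B * 1 := by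
    intro a b hab
    refine ⟨?_, by have := hΔ a b; linarith⟩
    calc (1:ℝ) = δ⁻¹ * δ := by field_simp
      _ ≤ B * d a b := by gcongr
  refine ⟨f, ?_, B, hB0, ?_⟩
  · apply Set.Subset.antisymm
    · rintro _ ⟨z, rfl⟩
      simp only [f]
      split_ifs
      · exact Or.inr ⟨_, rfl⟩
      · exact Or.inl ⟨_, rfl⟩
    · rintro _ (⟨w, rfl⟩ | ⟨w, rfl⟩)
      · by_cases hw : fstOne w
        · refine ⟨cns zero w, ?_⟩
          have : fstOne (cns zero w) := by
            obtain ⟨k, hk, hk0⟩ := hw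
            refine ⟨k+1, hk, fun l hl => ?_⟩
            cases l with
            | zero => rfl
            | succ l => exact hk0 l (by omega)
          simp [f, squ, this, zero]
        · refine ⟨w, ?_⟩
          have : (w 0 : ℕ) ≠ 1 := fun h => hw ⟨0, h, fun l hl => by omega⟩
          simp [f, squ, hw, this]
      · exact ⟨cns one w, by simp [f, one]⟩
  · intro x y
    simp only [f]
    split_ifs with hx hy hy
    · have e : x 0 = y 0 := Fin.ext (by omega)
      rw [symb_sh h0 h1 e]
      obtain ⟨a, b⟩ := hg' (sh x) (sh y)
      have s0 := symb_nonneg h0 (sh x) (sh y)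
      have d0 : 0 ≤ d (g' (sh x)) (g' (sh y)) := by
        by_contra hc
        push Not at hc
        nlinarith
      constructor
      · calc r * symbDist r (sh x) (sh y) ≤ 1 * symbDist r (sh x) (sh y) := by gcongr
          _ ≤ C' * d (g' (sh x)) (g' (sh y)) := by linarith
          _ ≤ _ := by gcongr
      · calc _ ≤ C' * symbDist r (sh x) (sh y) := b
          _ = (C' * r⁻¹) * (r * symbDist r (sh x) (sh y)) := by field_simp
          _ ≤ _ := by gcongr
    · rw [symb_one (by intro e; rw [e] at hx; exact hy hx), hdc]
      exact cross _ _ (hsep _ ⟨_, rfl⟩ _ ⟨_, rfl⟩)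
    · rw [symb_one (by intro e; rw [e] at hx; exact hx hy)]
      exact cross _ _ (hsep _ ⟨_, rfl⟩ _ ⟨_, rfl⟩)
    · obtain ⟨a, b⟩ := hg (squ x) (squ y)
      obtain ⟨u, v⟩ := squ_compare h0 h1 hx hy
      have s0 := symb_nonneg h0 x y
      have d0 : 0 ≤ d (g (squ x)) (g (squ y)) := by
        by_contra hc
        push Not at hc
        nlinarith
      constructor
      · calc _ ≤ C * d (g (squ x)) (g (squ y)) := u.trans a
          _ ≤ _ := by gcongr
      · calc _ ≤ C * symbDist r (squ x) (squ y) := b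
          _ ≤ C * (r⁻¹ * symbDist r x y) := by gcongr
          _ = (C * r⁻¹) * symbDist r x y := by ring
          _ ≤ _ := by gcongr

def Good {X : Type*} (d : X → X → ℝ) (m : ℕ) (r : ℝ) (K : Set X) : Prop := K = ∅ ∨ Par d m r K

lemma Good.union {X : Type*} {d : X → X → ℝ} {m : ℕ} (hm : 2 ≤ m) {r : ℝ} (h0 : 0 < r) (h1 : r < 1)
    {K K' : Set X} (h : Good d m r K) (h' : Good d m r K') {δ Δ : ℝ} (hδ : 0 < δ)
    (hdc : ∀ x y, d x y = d y x) (hΔ : ∀ x y, d x y ≤ Δ)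
    (hsep : ∀ x ∈ K, ∀ y ∈ K', δ ≤ d x y) : Good d m r (K ∪ K') := by
  rcases h with rfl | h
  · simpa using h'
  rcases h' with rfl | h'
  · right; simpa using h
  · exact Or.inr (h.union hm h0 h1 h' hδ hdc hΔ hsep)

lemma Good.image {X : Type*} {d : X → X → ℝ} {m : ℕ} {r : ℝ} (h0 : 0 < r)
    {K : Set X} (h : Good d m r K)
    (S : X → X) {q : ℝ} (hq : 0 < q) (hS : ∀ x y, d (S x) (S y) = q * d x y) :
    Good d m r (S '' K) := by
  rcases h with rfl | h
  · left; simp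
  · exact Or.inr (h.image h0 S hq hS)

lemma Good.iUnion {X : Type*} {d : X → X → ℝ} {m : ℕ} (hm : 2 ≤ m) {r : ℝ} (h0 : 0 < r) (h1 : r < 1)
    {J : Type*} [Finite J] {K : J → Set X} (h : ∀ a, Good d m r (K a)) {δ Δ : ℝ} (hδ : 0 < δ)
    (hdc : ∀ x y, d x y = d y x) (hΔ : ∀ x y, d x y ≤ Δ)
    (hsep : ∀ a b, a ≠ b → ∀ x ∈ K a, ∀ y ∈ K b, δ ≤ d x y) : Good d m r (⋃ a, K a) := by
  have := Fintype.ofFinite J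
  have key : ∀ F : Finset J, Good d m r (⋃ a ∈ F, K a) := by
    intro F
    induction F using Finset.induction_on with
    | empty => left; simp
    | insert a F ha ih =>
      rw [Finset.set_biUnion_insert]
      refine (h a).union hm h0 h1 ih hδ hdc hΔ ?_
      intro x hx y hy
      simp only [Set.mem_iUnion] at hy
      obtain ⟨b, hb, hy⟩ := hy
      exact hsep a b (by rintro rfl; exact ha hb) x hx y hy
  simpa using key Finset.univ

lemma Par.of_bilip {X : Type*} [MetricSpace X] {K : Set X} {m : ℕ} {r : ℝ}
    (h : BilipWithSymb K m r) : Par (fun x y : X => dist x y) m r K := by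
  obtain ⟨f, hf, C, hC, hb⟩ := h
  let e := Equiv.ofBijective f hf
  refine ⟨fun z => (e.symm z : X), ?_, C, by linarith, fun x y => ?_⟩
  · have := e.symm.surjective.range_eq
    rw [show (fun z => (e.symm z : X)) = Subtype.val ∘ e.symm from rfl, Set.range_comp, this]
    simp
  · obtain ⟨a, b⟩ := hb (e.symm x) (e.symm y)
    have ex : ∀ x, f (e.symm x) = x := fun x => e.apply_symm_apply x
    rw [ex, ex] at a b
    rw [inv_mul_le_iff₀ (by linarith)] at a
    exact ⟨b, a⟩

lemma Par.bilip {X : Type*} [MetricSpace X] {K : Set X} {m : ℕ} {r : ℝ} (h0 : 0 < r)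
    (h : Par (fun x y : X => dist x y) m r K) : BilipWithSymb K m r := by
  obtain ⟨g, rfl, C, hC, hg⟩ := h
  have inj : Function.Injective g := by
    intro x y hxy
    apply symb_eq h0
    have := (hg x y).1
    simpa [hxy] using this
  let e := Equiv.ofInjective g inj
  refine ⟨e.symm, e.symm.bijective, max C 1, le_max_right _ _, fun x y => ?_⟩
  obtain ⟨x, rfl⟩ := e.surjective x
  obtain ⟨y, rfl⟩ := e.surjective y
  simp only [Equiv.symm_apply_apply]
  have hC1 : 0 < max C 1 := by positivity
  rw [inv_mul_le_iff₀ hC1]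
  obtain ⟨a, b⟩ := hg x y
  have : dist (e x) (e y) = dist (g x) (g y) := rfl
  rw [this]
  have := symb_nonneg h0 x y
  constructor
  · exact b.trans (by gcongr; exact le_max_left _ _)
  · exact a.trans (by gcongr; exact le_max_left _ _)

/-- recoding by blocks of length `n` -/
lemma exists_recode {m n : ℕ} (hn : 0 < n) {r : ℝ} (h0 : 0 < r) (h1 : r < 1) :
    ∃ c : (ℕ → Fin m) ≃ (ℕ → Fin (m ^ n)), ∃ C : ℝ, 0 < C ∧ ∀ x y,
      symbDist r x y ≤ symbDist (r^n) (c x) (c y) ∧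
      symbDist (r^n) (c x) (c y) ≤ C * symbDist r x y := by
  have hm' : NeZero n := ⟨hn.ne'⟩
  let c1 : (ℕ → Fin m) ≃ (ℕ × Fin n → Fin m) := Equiv.arrowCongr (Nat.divModEquiv n) (Equiv.refl _)
  let c2 : (ℕ × Fin n → Fin m) ≃ (ℕ → Fin n → Fin m) := Equiv.curry _ _ _
  let c3 : (ℕ → Fin n → Fin m) ≃ (ℕ → Fin (m ^ n)) :=
    Equiv.arrowCongr (Equiv.refl _) finFunctionFinEquiv
  let c := c1.trans (c2.trans c3)
  have hc : ∀ x j, c x j = finFunctionFinEquiv (fun i : Fin n => x (j * n + i)) := by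
    intro x j
    simp only [c, c1, c2, c3, Equiv.trans_apply, Equiv.arrowCongr_apply, Equiv.coe_refl, Function.comp,
      Equiv.curry_apply, Equiv.refl_symm, id]
    congr 1
  have h0' : 0 < r ^ n := pow_pos h0 n
  have h1' : r ^ n < 1 := pow_lt_one₀ h0.le h1 hn.ne'
  have hag : ∀ x y j, agr j (c x) (c y) ↔ agr (j * n) x y := by
    intro x y j
    constructor
    · intro h l hl
      have hd : l / n < j := (Nat.div_lt_iff_lt_mul hn).2 hl
      have := h (l / n) hd
      rw [hc, hc] at this
      have := congrFun (finFunctionFinEquiv.injective this) ⟨l % n, Nat.mod_lt _ hn⟩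
      simpa [Nat.div_add_mod'] using this
    · intro h l hl
      rw [hc, hc]
      congr 1
      funext i
      apply h
      calc l * n + i < l * n + n := by have := i.2; omega
        _ = (l+1) * n := by ring
        _ ≤ j * n := Nat.mul_le_mul_right _ hl
  refine ⟨c, (r^n)⁻¹, by positivity, fun x y => ⟨?_, ?_⟩⟩
  · rcases symb_cases (r := r^n) (c x) (c y) with h | ⟨k, hk, ha, -⟩
    · rw [h.1, c.injective h.2, symb_self]
    · rw [hk, ← pow_mul, symb_le_iff h0 h1, mul_comm]
      exact (hag _ _ _).1 ha
  · rcases symb_cases (r := r) x y with h | ⟨k, hk, ha, -⟩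
    · rw [h.2, symb_self, symb_self]; simp
    · have h2 : symbDist (r^n) (c x) (c y) ≤ (r^n)^(k/n) := by
        rw [symb_le_iff h0' h1', hag]
        intro l hl
        exact ha l (hl.trans_le (Nat.div_mul_le_self k n))
      rw [hk]
      refine h2.trans ?_
      rw [inv_mul_eq_div, le_div_iff₀ h0', ← pow_succ, ← pow_mul]
      apply pow_le_pow_of_le_one h0.le h1.le
      have := Nat.div_add_mod k n
      have := Nat.mod_lt k hn
      rw [mul_add]; omega

lemma par_recode {X : Type*} {d : X → X → ℝ} {m n : ℕ} (hn : 0 < n) {r : ℝ} (h0 : 0 < r)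
    (h1 : r < 1) {K : Set X} : Par d m r K ↔ Par d (m ^ n) (r ^ n) K := by
  obtain ⟨c, B, hB, hc⟩ := exists_recode (m := m) hn h0 h1
  constructor
  · rintro ⟨g, rfl, C, hC, hg⟩
    refine ⟨g ∘ c.symm, by rw [c.symm.surjective.range_comp], B * C + C, by positivity, fun x y => ?_⟩
    obtain ⟨x, rfl⟩ := c.surjective x
    obtain ⟨y, rfl⟩ := c.surjective y
    simp only [Function.comp, Equiv.symm_apply_apply]
    obtain ⟨a, b⟩ := hg x y
    obtain ⟨u, v⟩ := hc x y
    have s0 := symb_nonneg h0 x y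
    have s1 := s0.trans u
    have : 0 ≤ C * d (g x) (g y) := by linarith
    have h2 : B * symbDist r x y ≤ B * (C * d (g x) (g y)) := by gcongr
    have h3 : C * symbDist r x y ≤ C * symbDist (r^n) (c x) (c y) := by gcongr
    have h4 : 0 ≤ B * C * symbDist (r^n) (c x) (c y) := by positivity
    constructor <;> linarith
  · rintro ⟨g, rfl, C, hC, hg⟩
    refine ⟨g ∘ c, by rw [c.surjective.range_comp], B * C + C, by positivity, fun x y => ?_⟩
    obtain ⟨a, b⟩ := hg (c x) (c y)
    obtain ⟨u, v⟩ := hc x y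
    simp only [Function.comp]
    have s0 := symb_nonneg h0 x y
    have s1 := s0.trans u
    have : 0 ≤ C * d (g (c x)) (g (c y)) := by linarith
    have h2 : 0 ≤ B * (C * d (g (c x)) (g (c y))) := by positivity
    have h3 : C * symbDist (r^n) (c x) (c y) ≤ C * (B * symbDist r x y) := by gcongr
    have h4 : 0 ≤ C * symbDist r x y := by positivity
    constructor <;> linarith

lemma exists_sep {X : Type*} [MetricSpace X] {J : Type*} [Finite J] (A : J → Set X)
    (hA : ∀ a, IsCompact (A a)) :
    ∃ δ : ℝ, 0 < δ ∧ ∀ a b, Disjoint (A a) (A b) → ∀ x ∈ A a, ∀ y ∈ A b, δ ≤ dist x y := by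
  have := Fintype.ofFinite J
  have h1 : ∀ p : J × J, ∃ δ : ℝ, 0 < δ ∧ (Disjoint (A p.1) (A p.2) →
      ∀ x ∈ A p.1, ∀ y ∈ A p.2, δ ≤ dist x y) := by
    rintro ⟨a, b⟩
    by_cases hd : Disjoint (A a) (A b)
    · obtain ⟨ε, hε, h⟩ := Metric.exists_pos_forall_lt_edist (hA a) (hA b).isClosed hd
      refine ⟨ε, hε, fun _ x hx y hy => ?_⟩
      have := h x hx y hy
      rw [edist_nndist] at this
      have := ENNReal.coe_lt_coe.1 this
      have := NNReal.coe_lt_coe.2 this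
      simpa using this.le
    · exact ⟨1, one_pos, fun h => absurd h hd⟩
  choose f hf0 hf using h1
  rcases isEmpty_or_nonempty J with hJ | hJ
  · exact ⟨1, one_pos, fun a => hJ.elim a⟩
  · obtain ⟨p, hp⟩ := Finite.exists_min f
    exact ⟨f p, hf0 p, fun a b hd x hx y hy => (hp (a, b)).trans (hf (a, b) hd x hx y hy)⟩

lemma exists_dist_bound (X : Type*) [MetricSpace X] [CompactSpace X] :
    ∃ Δ : ℝ, 0 < Δ ∧ ∀ x y : X, dist x y ≤ Δ := by
  obtain ⟨C, hC⟩ := (Metric.isBounded_iff.1 (isCompact_univ (X := X)).isBounded)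
  exact ⟨max C 1, by positivity, fun x y => (hC (Set.mem_univ x) (Set.mem_univ y)).trans (le_max_left _ _)⟩

lemma Good.iUnion_compact {X : Type*} [MetricSpace X] [CompactSpace X] {m : ℕ} (hm : 2 ≤ m)
    {r : ℝ} (h0 : 0 < r) (h1 : r < 1) {J : Type*} [Finite J] {K : J → Set X}
    (h : ∀ a, Good (fun x y : X => dist x y) m r (K a)) (hc : ∀ a, IsCompact (K a))
    (hd : ∀ a b, a ≠ b → Disjoint (K a) (K b)) :
    Good (fun x y : X => dist x y) m r (⋃ a, K a) := by
  obtain ⟨δ, hδ, hs⟩ := exists_sep K hc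
  obtain ⟨Δ, -, hΔ⟩ := exists_dist_bound X
  exact Good.iUnion hm h0 h1 h hδ dist_comm hΔ (fun a b hab => hs a b (hd a b hab))

lemma Good.union_compact {X : Type*} [MetricSpace X] [CompactSpace X] {m : ℕ} (hm : 2 ≤ m)
    {r : ℝ} (h0 : 0 < r) (h1 : r < 1) {K K' : Set X}
    (h : Good (fun x y : X => dist x y) m r K) (h' : Good (fun x y : X => dist x y) m r K')
    (hc : IsCompact K) (hc' : IsCompact K') (hd : Disjoint K K') :
    Good (fun x y : X => dist x y) m r (K ∪ K') := by
  rw [Set.union_eq_iUnion]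
  refine Good.iUnion_compact hm h0 h1 ?_ ?_ ?_
  · intro b; cases b <;> assumption
  · intro b; cases b <;> assumption
  · intro a b hab
    cases a <;> cases b <;> simp at hab ⊢
    · exact hd.symm
    · exact hd

lemma sim_continuous {X : Type*} [MetricSpace X] {S : X → X} {q : ℝ} (hq : 0 ≤ q)
    (h : ∀ x y, dist (S x) (S y) = q * dist x y) : Continuous S :=
  (LipschitzWith.of_dist_le_mul (K := ⟨q, hq⟩) (fun x y => (h x y).le)).continuous

lemma sim_injective {X : Type*} [MetricSpace X] {S : X → X} {q : ℝ} (hq : 0 < q)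
    (h : ∀ x y, dist (S x) (S y) = q * dist x y) : Function.Injective S := by
  intro x y hxy
  have := h x y
  rw [hxy, dist_self] at this
  have : dist x y = 0 := by
    rcases mul_eq_zero.1 this.symm with h | h
    · exact absurd h hq.ne'
    · exact h
  exact dist_eq_zero.1 this

structure Sys (X : Type*) [MetricSpace X] (ι : Type) (K : ι → Set X) (q : ℝ) (m : ℕ) (r : ℝ) where
  E : ι → Type
  fin : ∀ i, Fintype (E i)
  t : ∀ i, E i → ι
  S : ∀ i, E i → X → X
  sim : ∀ i e x y, dist (S i e x) (S i e y) = q * dist x y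
  R : ι → Set X
  Rc : ∀ i, IsCompact (R i)
  cover : ∀ i, K i = R i ∪ ⋃ e, S i e '' K (t i e)
  disjR : ∀ i e, Disjoint (R i) (S i e '' K (t i e))
  disjE : ∀ i e e', e ≠ e' → Disjoint (S i e '' K (t i e)) (S i e' '' K (t i e'))
  good : ∀ i, Good (fun x y : X => dist x y) m r (R i)

attribute [instance] Sys.fin

lemma Sys.R_sub {X : Type*} [MetricSpace X] {ι : Type} {K : ι → Set X} {q : ℝ} {m : ℕ} {r : ℝ}
    (A : Sys X ι K q m r) (i : ι) : A.R i ⊆ K i := by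
  rw [A.cover i]; exact Set.subset_union_left

lemma Sys.S_sub {X : Type*} [MetricSpace X] {ι : Type} {K : ι → Set X} {q : ℝ} {m : ℕ} {r : ℝ}
    (A : Sys X ι K q m r) (i : ι) (e : A.E i) : A.S i e '' K (A.t i e) ⊆ K i := by
  conv_rhs => rw [A.cover i]
  exact (Set.subset_iUnion (fun e => A.S i e '' K (A.t i e)) e).trans Set.subset_union_right

def Sys.one {X : Type*} [MetricSpace X] {ι : Type} (K : ι → Set X) (m : ℕ) (r : ℝ) :
    Sys X ι K 1 m r where
  E _ := Unit
  fin _ := inferInstance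
  t i _ := i
  S _ _ := id
  sim := by simp
  R _ := ∅
  Rc := by simp
  cover := by
    intro i
    change K i = ∅ ∪ ⋃ _ : Unit, id '' K i
    simp [Set.iUnion_const]
  disjR := by simp
  disjE := by intro i e e' h; exact absurd rfl h
  good _ := Or.inl rfl

def Sys.comp {X : Type*} [MetricSpace X] [CompactSpace X] {ι : Type} {K : ι → Set X}
    {q q' : ℝ} {m : ℕ} (hm : 2 ≤ m) {r : ℝ} (h0 : 0 < r) (h1 : r < 1) (hq : 0 < q)
    (A : Sys X ι K q m r) (B : Sys X ι K q' m r) : Sys X ι K (q * q') m r where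
  E i := Σ e : A.E i, B.E (A.t i e)
  fin i := inferInstance
  t i e := B.t _ e.2
  S i e x := A.S i e.1 (B.S _ e.2 x)
  sim i e x y := by rw [A.sim, B.sim, mul_assoc]
  R i := A.R i ∪ ⋃ e, A.S i e '' B.R (A.t i e)
  Rc i := (A.Rc i).union (isCompact_iUnion fun e =>
    (B.Rc _).image (sim_continuous hq.le (A.sim i e)))
  cover i := by
    conv_lhs => rw [A.cover i]
    rw [Set.union_assoc]
    congr 1
    have : ∀ e, A.S i e '' K (A.t i e) = A.S i e '' B.R (A.t i e) ∪
        ⋃ e', (fun x => A.S i e (B.S (A.t i e) e' x)) '' K (B.t _ e') := by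
      intro e
      conv_lhs => rw [B.cover (A.t i e)]
      rw [Set.image_union, Set.image_iUnion]
      congr 1
      apply Set.iUnion_congr
      intro e'
      rw [Set.image_image]
    simp_rw [this]
    rw [Set.iUnion_union_distrib, Set.iUnion_sigma]
  disjR i := by
    rintro ⟨e, e'⟩
    have hsub : (fun x => A.S i e (B.S (A.t i e) e' x)) '' K (B.t _ e') ⊆ A.S i e '' K (A.t i e) := by
      rw [← Set.image_image]
      exact Set.image_mono (B.S_sub _ _)
    rw [Set.disjoint_union_left]
    refine ⟨(A.disjR i e).mono_right hsub, ?_⟩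
    rw [Set.disjoint_iUnion_left]
    intro e2
    by_cases he : e2 = e
    · subst he
      change Disjoint _ ((fun x => A.S i e2 (B.S (A.t i e2) e' x)) '' K (B.t _ e'))
      rw [← Set.image_image (A.S i e2) (B.S (A.t i e2) e'),
        Set.disjoint_image_iff (sim_injective hq (A.sim i e2))]
      exact B.disjR _ _
    · exact (A.disjE i e2 e he).mono (Set.image_mono (B.R_sub _)) hsub
  disjE i := by
    rintro ⟨e, e'⟩ ⟨f, f'⟩ hne
    have hsub : ∀ e e', (fun x => A.S i e (B.S (A.t i e) e' x)) '' K (B.t _ e') ⊆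
        A.S i e '' K (A.t i e) := by
      intro e e'
      rw [← Set.image_image]
      exact Set.image_mono (B.S_sub _ _)
    by_cases he : e = f
    · subst he
      change Disjoint ((fun x => A.S i e (B.S (A.t i e) e' x)) '' K (B.t _ e'))
        ((fun x => A.S i e (B.S (A.t i e) f' x)) '' K (B.t _ f'))
      rw [← Set.image_image (A.S i e) (B.S (A.t i e) e'),
        ← Set.image_image (A.S i e) (B.S (A.t i e) f'),
        Set.disjoint_image_iff (sim_injective hq (A.sim i e))]
      apply B.disjE
      rintro rfl
      exact hne rfl
    · exact (A.disjE i e f he).mono (hsub e e') (hsub f f')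
  good i := by
    have hc : ∀ e, IsCompact (A.S i e '' B.R (A.t i e)) := fun e =>
      (B.Rc _).image (sim_continuous hq.le (A.sim i e))
    refine (A.good i).union_compact hm h0 h1 ?_ (A.Rc i) (isCompact_iUnion hc) ?_
    · refine Good.iUnion_compact hm h0 h1 ?_ hc ?_
      · intro e
        exact (B.good _).image h0 _ hq (A.sim i e)
      · intro e f hef
        exact (A.disjE i e f hef).mono (Set.image_mono (B.R_sub _)) (Set.image_mono (B.R_sub _))
    · rw [Set.disjoint_iUnion_right]
      intro e
      exact (A.disjR i e).mono_right (Set.image_mono (B.R_sub _))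

/-- iteration of a system -/
lemma Sys.exists_iter {X : Type*} [MetricSpace X] [CompactSpace X] {ι : Type} [Fintype ι]
    [DecidableEq ι] {K : ι → Set X}
    {m : ℕ} (hm : 2 ≤ m) {r : ℝ} (h0 : 0 < r) (h1 : r < 1)
    (A : Sys X ι K r m r) (D : Matrix ι ι ℝ) (v : ι → ℝ)
    (hD : ∀ w i, ∑ e, w (A.t i e) = (D.mulVec w) i)
    (hR : ∀ i, A.R i = ∅ → (D.mulVec v) i = m * v i) (n : ℕ) :
    ∃ B : Sys X ι K (r ^ n) m r, (∀ w i, ∑ e, w (B.t i e) = ((D ^ n).mulVec w) i) ∧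
      ∀ i, B.R i = ∅ → ((D ^ n).mulVec v) i = m ^ n * v i := by
  induction n with
  | zero =>
    rw [pow_zero]
    refine ⟨Sys.one K m r, ?_, ?_⟩
    · intro w i
      change ∑ _e : Unit, w i = _
      simp
    · intro i _
      simp
  | succ n ih =>
    obtain ⟨B, hB1, hB2⟩ := ih
    rw [pow_succ']
    refine ⟨A.comp hm h0 h1 h0 B, ?_, ?_⟩
    · intro w i
      rw [pow_succ', ← Matrix.mulVec_mulVec, ← hD]
      simp_rw [← hB1]
      change ∑ e : (Σ e : A.E i, B.E (A.t i e)), w (B.t _ e.2) = _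
      rw [Fintype.sum_sigma]
    · intro i hi
      change A.R i ∪ ⋃ e, A.S i e '' B.R (A.t i e) = ∅ at hi
      rw [Set.union_empty_iff] at hi
      obtain ⟨hi1, hi2⟩ := hi
      rw [Set.iUnion_eq_empty] at hi2
      rw [pow_succ' D, ← Matrix.mulVec_mulVec, ← hD]
      have : ∀ e, ((D ^ n).mulVec v) (A.t i e) = m ^ n * v (A.t i e) := by
        intro e
        apply hB2
        simpa using hi2 e
      simp_rw [this]
      rw [← Finset.mul_sum, hD, hR i hi1]
      ring

lemma scale_bound {P : Type*} {f g : P → ℝ} {C B q : ℝ} (h0 : 0 < q) (h1 : q < 1)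
    (hB : ∀ p, f p ≤ B)
    (h : ∀ p, f p ≤ C * g p ∨ ∃ p', f p = q * f p' ∧ g p = q * g p') (hCg : ∀ p, 0 ≤ C * g p)
    (hB0 : 0 ≤ B) :
    ∀ p, f p ≤ C * g p := by
  have key : ∀ n : ℕ, ∀ p, f p ≤ C * g p + B * q ^ n := by
    intro n
    induction n with
    | zero => intro p; have := hB p; have := hCg p; simp; linarith
    | succ n ih =>
      intro p
      rcases h p with h | ⟨p', h2, h3⟩
      · have : 0 ≤ B * q ^ (n+1) := by positivity
        linarith
      · rw [h2, h3]
        have := mul_le_mul_of_nonneg_left (ih p') h0.le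
        rw [pow_succ]
        linarith
  intro p
  have hl : Filter.Tendsto (fun n : ℕ => C * g p + B * q ^ n) Filter.atTop
      (nhds (C * g p + B * 0)) :=
    ((tendsto_pow_atTop_nhds_zero_of_lt_one h0.le h1).const_mul B).const_add _
  have := ge_of_tendsto' hl (fun n => key n p)
  simpa using this

lemma par_words {M : ℕ} (hM : 2 ≤ M) {q : ℝ} (h0 : 0 < q) (h1 : q < 1) (U : Set (Fin M))
    (hU : U.Nonempty) : Par (fun x y : ℕ → Fin M => symbDist q x y) M q {z | z 0 ∈ U} := by
  have hun : Par (fun x y : ℕ → Fin M => symbDist q x y) M q Set.univ :=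
    ⟨id, by simp, 1, one_pos, fun x y => by simp⟩
  have e : {z : ℕ → Fin M | z 0 ∈ U} = ⋃ u : U, cns (u : Fin M) '' Set.univ := by
    ext z
    rw [Set.mem_iUnion]
    constructor
    · intro h
      exact ⟨⟨z 0, h⟩, sh z, trivial, cns_sh z⟩
    · rintro ⟨u, w, -, rfl⟩
      exact u.2
  have hg : Good (fun x y : ℕ → Fin M => symbDist q x y) M q {z | z 0 ∈ U} := by
    rw [e]
    refine Good.iUnion hM h0 h1 ?_ (δ := 1) (Δ := 1) one_pos symb_comm (symb_le_one h0 h1) ?_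
    · intro u
      refine Or.inr (hun.image h0 _ h0 ?_)
      intro x y
      simpa using symb_sh h0 h1 (x := cns (u : Fin M) x) (y := cns (u : Fin M) y) rfl
    · rintro a b hab _ ⟨x, -, rfl⟩ _ ⟨y, -, rfl⟩
      rw [symb_one]
      simpa [Subtype.ext_iff] using hab
  rcases hg with h | h
  · obtain ⟨u, hu⟩ := hU
    have : (fun _ => u) ∈ {z : ℕ → Fin M | z 0 ∈ U} := hu
    rw [h] at this
    exact this.elim
  · exact h

lemma par_trans {X Y : Type*} [Nonempty Y] {d : X → X → ℝ} {d' : Y → Y → ℝ} {M : ℕ} {q : ℝ} (h0 : 0 < q)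
    (hd' : ∀ x, d x x = 0)
    {R : Set X} {W : Set Y} (h : Par d M q R) (h' : Par d' M q W) :
    ∃ G : X → Y, (∀ x ∈ R, G x ∈ W) ∧ (∀ z ∈ W, ∃ x ∈ R, G x = z) ∧ ∃ C : ℝ, 0 < C ∧
      ∀ x ∈ R, ∀ y ∈ R, d x y ≤ C * d' (G x) (G y) ∧ d' (G x) (G y) ≤ C * d x y := by
  obtain ⟨g, rfl, C, hC, hg⟩ := h
  obtain ⟨k, rfl, C', hC', hk⟩ := h'
  have inj : Function.Injective g := by
    intro x y hxy
    apply symb_eq h0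
    have := (hg x y).1
    simpa [hxy, hd'] using this
  by_cases hne : Nonempty (ℕ → Fin M)
  · have hl : ∀ x, Function.invFun g (g x) = x := Function.leftInverse_invFun inj
    refine ⟨fun x => k (Function.invFun g x), ?_, ?_, C * C', by positivity, ?_⟩
    · rintro _ ⟨x, rfl⟩
      exact ⟨_, rfl⟩
    · rintro _ ⟨x, rfl⟩
      exact ⟨g x, ⟨x, rfl⟩, by simp [hl]⟩
    · rintro _ ⟨x, rfl⟩ _ ⟨y, rfl⟩
      simp only [hl]
      obtain ⟨a, b⟩ := hg x y
      obtain ⟨u, v⟩ := hk x y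
      constructor
      · calc _ ≤ C * symbDist q x y := b
          _ ≤ C * (C' * d' (k x) (k y)) := by gcongr
          _ = _ := by ring
      · calc _ ≤ C' * symbDist q x y := v
          _ ≤ C' * (C * d (g x) (g y)) := by gcongr
          _ = _ := by ring
  · refine ⟨fun _ => Classical.arbitrary Y, ?_, ?_, 1, one_pos, ?_⟩
    · rintro _ ⟨x, rfl⟩; exact (hne ⟨x⟩).elim
    · rintro _ ⟨x, rfl⟩; exact (hne ⟨x⟩).elim
    · rintro _ ⟨x, rfl⟩; exact (hne ⟨x⟩).elim

noncomputable def glueF {X : Type*} [MetricSpace X] {ι : Type} {K : ι → Set X} {q : ℝ} {M : ℕ}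
    (A : Sys X ι K q M q) (φ : ∀ i, A.E i → Fin M) (G : ι → X → ℕ → Fin M) :
    ℕ → ι → X → Fin M
  | 0, i, x => if h : ∃ p : A.E i × X, p.2 ∈ K (A.t i p.1) ∧ A.S i p.1 p.2 = x then
      φ i h.choose.1 else G i x 0
  | n+1, i, x => if h : ∃ p : A.E i × X, p.2 ∈ K (A.t i p.1) ∧ A.S i p.1 p.2 = x then
      glueF A φ G n (A.t i h.choose.1) h.choose.2 else G i x (n+1)

theorem Sys.glue {X : Type*} [MetricSpace X] [CompactSpace X] {ι : Type} [Finite ι]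
    {K : ι → Set X} (hKc : ∀ i, IsCompact (K i)) {M : ℕ} (hM : 2 ≤ M) {q : ℝ} (h0 : 0 < q)
    (h1 : q < 1) (A : Sys X ι K q M q) (hcard : ∀ i, Fintype.card (A.E i) < M)
    (hR : ∀ i, A.R i ≠ ∅) (i : ι) : Par (fun x y : X => dist x y) M q (K i) := by
  have hφ : ∀ i, ∃ φ : A.E i → Fin M, Function.Injective φ ∧ (Set.range φ)ᶜ.Nonempty := by
    intro i
    obtain ⟨φ⟩ := Function.Embedding.nonempty_of_card_le (α := A.E i) (β := Fin M)
      (by simpa using (hcard i).le)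
    refine ⟨φ, φ.injective, ?_⟩
    by_contra hc
    rw [Set.not_nonempty_iff_eq_empty, Set.compl_empty_iff, Set.range_eq_univ] at hc
    have := Fintype.card_le_of_surjective φ hc
    have := hcard i
    simp at *
    omega
  choose φ hφi hφn using hφ
  have hG : ∀ i, ∃ G : X → ℕ → Fin M, (∀ x ∈ A.R i, G x ∈ {z : ℕ → Fin M | z 0 ∈ (Set.range (φ i))ᶜ}) ∧
      (∀ z ∈ {z : ℕ → Fin M | z 0 ∈ (Set.range (φ i))ᶜ}, ∃ x ∈ A.R i, G x = z) ∧
      ∃ C : ℝ, 0 < C ∧ ∀ x ∈ A.R i, ∀ y ∈ A.R i, dist x y ≤ C * symbDist q (G x) (G y) ∧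
        symbDist q (G x) (G y) ≤ C * dist x y := by
    intro i
    have : Nonempty (ℕ → Fin M) := ⟨fun _ => ⟨0, by omega⟩⟩
    exact par_trans (d := fun x y : X => dist x y) (d' := fun x y => symbDist q x y) h0
      (fun x => dist_self x) ((A.good i).resolve_left (hR i))
      (par_words hM h0 h1 _ (hφn i))
  choose G hGm hGs C hC hGb using hG
  let F : ι → X → ℕ → Fin M := fun i x n => glueF A φ G n i x
  have hFR : ∀ i, ∀ x ∈ A.R i, F i x = G i x := by
    intro i x hx
    have : ¬ ∃ p : A.E i × X, p.2 ∈ K (A.t i p.1) ∧ A.S i p.1 p.2 = x := by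
      rintro ⟨p, hp, hpx⟩
      exact Set.disjoint_left.1 (A.disjR i p.1) hx ⟨p.2, hp, hpx⟩
    funext n
    cases n <;> simp [F, glueF, this]
  have hch : ∀ i (e : A.E i), ∀ y ∈ K (A.t i e),
      ∀ h : ∃ p : A.E i × X, p.2 ∈ K (A.t i p.1) ∧ A.S i p.1 p.2 = A.S i e y,
      h.choose = (e, y) := by
    intro i e y hy h
    obtain ⟨a, b⟩ := h.choose_spec
    have e1 : h.choose.1 = e := by
      by_contra hc
      exact Set.disjoint_left.1 (A.disjE i _ _ hc) ⟨_, a, b⟩ ⟨y, hy, rfl⟩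
    generalize h.choose = p at *
    obtain ⟨p1, p2⟩ := p
    simp only at e1
    subst e1
    have e2 : p2 = y := sim_injective h0 (A.sim i p1) b
    rw [e2]
  have hFS : ∀ i (e : A.E i), ∀ y ∈ K (A.t i e), F i (A.S i e y) = cns (φ i e) (F (A.t i e) y) := by
    intro i e y hy
    have h : ∃ p : A.E i × X, p.2 ∈ K (A.t i p.1) ∧ A.S i p.1 p.2 = A.S i e y := ⟨(e, y), hy, rfl⟩
    have hc := hch i e y hy h
    funext n
    cases n with
    | zero =>
      simp only [F, glueF, dif_pos h, cns_zero]
      rw [hc]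
    | succ n =>
      simp only [F, glueF, dif_pos h, cns_succ]
      rw [hc]
  -- constants
  obtain ⟨Δ, hΔ0, hΔ⟩ := exists_dist_bound X
  obtain ⟨δ, hδ, hsep⟩ := exists_sep (J := Σ i, Option (A.E i))
    (fun a => match a.2 with
      | none => A.R a.1
      | some e => A.S a.1 e '' K (A.t a.1 e)) (by
      rintro ⟨i, _ | e⟩
      · exact A.Rc i
      · exact (hKc _).image (sim_continuous h0.le (A.sim i e)))
  have hsepR : ∀ i e, ∀ x ∈ A.R i, ∀ y ∈ A.S i e '' K (A.t i e), δ ≤ dist x y := fun i e =>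
    hsep ⟨i, none⟩ ⟨i, some e⟩ (A.disjR i e)
  have hsepE : ∀ i e e', e ≠ e' → ∀ x ∈ A.S i e '' K (A.t i e), ∀ y ∈ A.S i e' '' K (A.t i e'),
      δ ≤ dist x y := fun i e e' h =>
    hsep ⟨i, some e⟩ ⟨i, some e'⟩ (A.disjE i e e' h)
  have : Nonempty ι := ⟨i⟩
  obtain ⟨j, hj⟩ := Finite.exists_max C
  set B := C j + δ⁻¹ + Δ with hB
  have hi0 : 0 < δ⁻¹ := by positivity
  have hCj := hC j
  have hB0 : 0 < B := by positivity
  have hCB : ∀ i, C i ≤ B := fun i => by have := hj i; linarith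
  have cross : ∀ x y : X, δ ≤ dist x y → ∀ s : ℝ, s = 1 → dist x y ≤ B * s ∧ s ≤ B * dist x y := by
    rintro x y hxy s rfl
    refine ⟨by have := hΔ x y; linarith, ?_⟩
    calc (1:ℝ) = δ⁻¹ * δ := by field_simp
      _ ≤ B * dist x y := by gcongr; linarith
  let P := {p : ι × X × X // p.2.1 ∈ K p.1 ∧ p.2.2 ∈ K p.1}
  let f : P → ℝ := fun p => dist p.1.2.1 p.1.2.2
  let g : P → ℝ := fun p => symbDist q (F p.1.1 p.1.2.1) (F p.1.1 p.1.2.2)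
  have hcase : ∀ p : P, (f p ≤ B * g p ∧ g p ≤ B * f p) ∨
      ∃ p', f p = q * f p' ∧ g p = q * g p' := by
    rintro ⟨⟨i, x, y⟩, hx, hy⟩
    simp only [f, g]
    simp only at hx hy
    rw [A.cover i, Set.mem_union, Set.mem_iUnion] at hx hy
    rcases hx with hx | ⟨e, hx⟩
    · rcases hy with hy | ⟨e', hy⟩
      · left
        obtain ⟨a, b⟩ := hGb i x hx y hy
        rw [hFR i x hx, hFR i y hy]
        have s0 := symb_nonneg h0 (G i x) (G i y)
        exact ⟨a.trans (by gcongr; exact hCB i), b.trans (by gcongr; exact hCB i)⟩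
      · left
        refine cross _ _ (hsepR i e' x hx y hy) _ (symb_one ?_)
        obtain ⟨y, hy, rfl⟩ := hy
        rw [hFR i x hx, hFS i e' y hy]
        intro hc
        exact hGm i x hx ⟨e', hc.symm⟩
    · rcases hy with hy | ⟨e', hy⟩
      · left
        refine cross _ _ (by rw [dist_comm]; exact hsepR i e y hy x hx) _ (symb_one ?_)
        obtain ⟨x, hx, rfl⟩ := hx
        rw [hFR i y hy, hFS i e x hx]
        intro hc
        exact hGm i y hy ⟨e, hc⟩
      · by_cases he : e = e'
        · subst he
          right
          obtain ⟨x, hx, rfl⟩ := hx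
          obtain ⟨y, hy, rfl⟩ := hy
          refine ⟨⟨⟨A.t i e, x, y⟩, hx, hy⟩, A.sim i e x y, ?_⟩
          rw [hFS i e x hx, hFS i e y hy, symb_sh h0 h1 (by rfl)]
          rfl
        · left
          refine cross _ _ (hsepE i e e' he x hx y hy) _ (symb_one ?_)
          obtain ⟨x, hx, rfl⟩ := hx
          obtain ⟨y, hy, rfl⟩ := hy
          rw [hFS i e x hx, hFS i e' y hy]
          intro hc
          exact he (hφi i hc)
  have hf0 : ∀ p, 0 ≤ f p := fun p => dist_nonneg
  have hg0 : ∀ p, 0 ≤ g p := fun p => symb_nonneg h0 _ _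
  have up1 : ∀ p, f p ≤ B * g p := scale_bound h0 h1 (B := Δ) (fun p => hΔ _ _)
    (fun p => (hcase p).imp And.left id) (fun p => mul_nonneg hB0.le (hg0 p)) hΔ0.le
  have up2 : ∀ p, g p ≤ B * f p := scale_bound h0 h1 (B := 1) (fun p => symb_le_one h0 h1 _ _)
    (fun p => (hcase p).imp And.right (fun ⟨p', a, b⟩ => ⟨p', b, a⟩))
    (fun p => mul_nonneg hB0.le (hf0 p)) zero_le_one
  have hdense : ∀ n i z, ∃ x ∈ K i, agr n (F i x) z := by
    intro n
    induction n with
    | zero =>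
      intro i z
      obtain ⟨x, hx⟩ := Set.nonempty_iff_ne_empty.2 (hR i)
      exact ⟨x, A.R_sub i hx, fun l hl => by omega⟩
    | succ n ih =>
      intro i z
      by_cases hz : z 0 ∈ Set.range (φ i)
      · obtain ⟨e, he⟩ := hz
        obtain ⟨x, hx, hxa⟩ := ih (A.t i e) (sh z)
        refine ⟨A.S i e x, A.S_sub i e ⟨x, hx, rfl⟩, ?_⟩
        rw [hFS i e x hx]
        intro l hl
        cases l with
        | zero => exact he
        | succ l => exact hxa l (by omega)
      · obtain ⟨x, hx, hxz⟩ := hGs i z hz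
        refine ⟨x, A.R_sub i hx, ?_⟩
        rw [hFR i x hx, hxz]
        exact fun _ _ => rfl
  have hsurj : ∀ z, ∃ x ∈ K i, F i x = z := by
    intro z
    choose u hu hua using fun n => hdense n i z
    obtain ⟨x, hx, ψ, hψ, hlim⟩ := (hKc i).tendsto_subseq hu
    refine ⟨x, hx, ?_⟩
    funext l
    rw [Metric.tendsto_atTop] at hlim
    obtain ⟨N, hN⟩ := hlim (q ^ (l+1) / B) (by positivity)
    let n := max N (l+1)
    have hd := hN n (le_max_left _ _)
    have h2 : l + 1 ≤ ψ n := (le_max_right N (l+1)).trans (hψ.id_le n)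
    have h3 := up2 ⟨⟨i, u (ψ n), x⟩, hu _, hx⟩
    simp only [f, g] at h3
    have h4 : symbDist q (F i (u (ψ n))) (F i x) ≤ q ^ (l+1) := by
      rw [lt_div_iff₀ hB0] at hd
      simp only [Function.comp] at hd
      linarith
    rw [symb_le_iff h0 h1] at h4
    rw [← h4 l (by omega)]
    exact hua (ψ n) l (by omega)
  choose k hk hkF using hsurj
  refine ⟨k, ?_, B, hB0, fun x y => ?_⟩
  · apply Set.Subset.antisymm
    · rintro _ ⟨z, rfl⟩; exact hk z
    · intro x hx
      refine ⟨F i x, ?_⟩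
      have := up1 ⟨⟨i, k (F i x), x⟩, hk _, hx⟩
      simp only [f, g, hkF, symb_self, mul_zero] at this
      exact dist_le_zero.1 this
  · have a := up1 ⟨⟨i, k x, k y⟩, hk _, hk _⟩
    have b := up2 ⟨⟨i, k x, k y⟩, hk _, hk _⟩
    simp only [f, g, hkF] at a b
    exact ⟨b, a⟩

lemma mulVec_mono_aux {ι : Type} [Fintype ι] {D : Matrix ι ι ℝ} (hD : ∀ i j, 0 ≤ D i j)
    {u w : ι → ℝ} (h : ∀ i, u i ≤ w i) (i : ι) : D.mulVec u i ≤ D.mulVec w i := by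
  simp only [Matrix.mulVec, dotProduct]
  exact Finset.sum_le_sum fun j _ => mul_le_mul_of_nonneg_left (h j) (hD i j)

lemma pow_nonneg_aux {ι : Type} [Fintype ι] [DecidableEq ι] {D : Matrix ι ι ℝ}
    (hD : ∀ i j, 0 ≤ D i j) (n : ℕ) : ∀ i j, 0 ≤ (D ^ n) i j := by
  induction n with
  | zero => intro i j; rw [pow_zero, Matrix.one_apply]; split_ifs <;> norm_num
  | succ n ih =>
    intro i j
    rw [pow_succ, Matrix.mul_apply]
    exact Finset.sum_nonneg fun k _ => mul_nonneg (ih i k) (hD k j)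

lemma exists_good_power {ι : Type} [Fintype ι] [DecidableEq ι] [Nonempty ι] {D : Matrix ι ι ℝ}
    (hD : ∀ i j, 0 ≤ D i j) (hirr : ∀ i j, ∃ k : ℕ, 0 < k ∧ 0 < (D ^ k) i j)
    {m : ℝ} (hm : 0 < m) {v : ι → ℝ} (hv : ∀ i, 0 < v i) (hle : ∀ i, D.mulVec v i ≤ m * v i)
    (hlt : ∃ j, D.mulVec v j < m * v j) :
    ∃ n : ℕ, 0 < n ∧ ∀ i, (D ^ n).mulVec v i < m ^ n * v i ∧
      (D ^ n).mulVec (fun _ => 1) i < m ^ n := by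
  have hstep : ∀ n i, (D ^ (n+1)).mulVec v i ≤ m * (D ^ n).mulVec v i := by
    intro n i
    rw [pow_succ, ← Matrix.mulVec_mulVec]
    have := mulVec_mono_aux (pow_nonneg_aux hD n) (u := D.mulVec v) (w := m • v) hle i
    rwa [Matrix.mulVec_smul, Pi.smul_apply, smul_eq_mul] at this
  have hall : ∀ n i, (D ^ n).mulVec v i ≤ m ^ n * v i := by
    intro n i
    induction n with
    | zero => simp
    | succ n ih =>
      refine (hstep n i).trans ?_
      rw [pow_succ', mul_assoc]
      gcongr
  have hup : ∀ i n n', n ≤ n' → (D ^ n).mulVec v i < m ^ n * v i →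
      (D ^ n').mulVec v i < m ^ n' * v i := by
    intro i n n' hnn h
    induction n', hnn using Nat.le_induction with
    | base => exact h
    | succ k _ ih =>
      refine (hstep k i).trans_lt ?_
      rw [pow_succ', mul_assoc]
      gcongr
  obtain ⟨j, hj⟩ := hlt
  have hstrict : ∀ i, ∃ n : ℕ, (D ^ n).mulVec v i < m ^ n * v i := by
    intro i
    obtain ⟨k, -, hk⟩ := hirr i j
    refine ⟨k+1, ?_⟩
    have h1 : (D ^ (k+1)).mulVec v i < m * (D ^ k).mulVec v i := by
      rw [pow_succ, ← Matrix.mulVec_mulVec]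
      have : m * (D ^ k).mulVec v i = (D ^ k).mulVec (m • v) i := by
        rw [Matrix.mulVec_smul, Pi.smul_apply, smul_eq_mul]
      rw [this]
      simp only [Matrix.mulVec, dotProduct]
      refine Finset.sum_lt_sum (fun l _ => ?_) ⟨j, Finset.mem_univ _, ?_⟩
      · exact mul_le_mul_of_nonneg_left (hle l) (pow_nonneg_aux hD k i l)
      · exact mul_lt_mul_of_pos_left hj hk
    refine h1.trans_le ?_
    rw [pow_succ', mul_assoc]
    have := hall k i
    gcongr
  choose N hN using hstrict
  obtain ⟨i0, hi0⟩ := Finite.exists_max N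
  set n0 := N i0 + 1 with hn0
  have hs : ∀ i, (D ^ n0).mulVec v i < m ^ n0 * v i := fun i =>
    hup i (N i) n0 (by have := hi0 i; omega) (hN i)
  obtain ⟨i1, hi1⟩ := Finite.exists_max (fun i => (D ^ n0).mulVec v i / (m ^ n0 * v i))
  set θ := (D ^ n0).mulVec v i1 / (m ^ n0 * v i1) with hθ
  have hpos : ∀ n i, 0 < m ^ n * v i := fun n i => mul_pos (pow_pos hm n) (hv i)
  have hθ1 : θ < 1 := by rw [hθ, div_lt_one (hpos _ _)]; exact hs i1
  have hθ0 : 0 ≤ θ := by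
    apply div_nonneg _ (hpos _ _).le
    simp only [Matrix.mulVec, dotProduct]
    exact Finset.sum_nonneg fun l _ => mul_nonneg (pow_nonneg_aux hD _ _ _) (hv l).le
  have hθv : ∀ i, (D ^ n0).mulVec v i ≤ ((θ * m ^ n0) • v) i := by
    intro i
    have := hi1 i
    rw [div_le_iff₀ (hpos _ _)] at this
    rw [Pi.smul_apply, smul_eq_mul, mul_assoc]
    exact this
  have hiter : ∀ p i, (D ^ (n0 * p)).mulVec v i ≤ (θ * m ^ n0) ^ p * v i := by
    intro p
    induction p with
    | zero => simp
    | succ p ih =>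
      intro i
      rw [Nat.mul_succ, pow_add, ← Matrix.mulVec_mulVec]
      refine (mulVec_mono_aux (pow_nonneg_aux hD _) hθv i).trans ?_
      rw [Matrix.mulVec_smul, Pi.smul_apply, smul_eq_mul, pow_succ' (θ * m ^ n0) p, mul_assoc (θ * m ^ n0)]
      have := ih i
      gcongr
  obtain ⟨i2, hi2⟩ := Finite.exists_min v
  have hone : ∀ i, (1:ℝ) ≤ ((v i2)⁻¹ • v) i := by
    intro i
    rw [Pi.smul_apply, smul_eq_mul, inv_mul_eq_div, le_div_iff₀ (hv i2), one_mul]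
    exact hi2 i
  have hev : ∀ i, ∀ᶠ p : ℕ in Filter.atTop, (v i2)⁻¹ * v i * θ ^ p < 1 := by
    intro i
    have := (tendsto_pow_atTop_nhds_zero_of_lt_one hθ0 hθ1).const_mul ((v i2)⁻¹ * v i)
    rw [mul_zero] at this
    exact this.eventually (gt_mem_nhds one_pos)
  obtain ⟨p, hp, hp1⟩ := ((Filter.eventually_all.2 hev).and (Filter.eventually_ge_atTop 1)).exists
  have hnp : n0 ≤ n0 * p := Nat.le_mul_of_pos_right _ hp1
  refine ⟨n0 * p, by omega, fun i => ⟨hup i n0 _ hnp (hs i), ?_⟩⟩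
  refine (mulVec_mono_aux (pow_nonneg_aux hD _) (u := fun _ => 1) hone i).trans_lt ?_
  rw [Matrix.mulVec_smul, Pi.smul_apply, smul_eq_mul]
  have h5 : 0 < (v i2)⁻¹ := inv_pos.2 (hv i2)
  calc (v i2)⁻¹ * (D ^ (n0 * p)).mulVec v i ≤ (v i2)⁻¹ * ((θ * m ^ n0) ^ p * v i) := by
        have := hiter p i
        gcongr
    _ = ((v i2)⁻¹ * v i * θ ^ p) * m ^ (n0 * p) := by rw [mul_pow, pow_mul]; ring
    _ < 1 * m ^ (n0 * p) := by
        have := hp i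
        gcongr
    _ = _ := one_mul _

def Sys.recode {X : Type*} [MetricSpace X] {ι : Type} {K : ι → Set X} {q : ℝ} {m : ℕ} {r : ℝ}
    (h0 : 0 < r) (h1 : r < 1) {n : ℕ} (hn : 0 < n) (A : Sys X ι K q m r) :
    Sys X ι K q (m ^ n) (r ^ n) where
  E := A.E
  fin := A.fin
  t := A.t
  S := A.S
  sim := A.sim
  R := A.R
  Rc := A.Rc
  cover := A.cover
  disjR := A.disjR
  disjE := A.disjE
  good i := (A.good i).imp id (par_recode hn h0 h1).1

def baseSys {X : Type*} [MetricSpace X] [CompactSpace X] {s t : ℕ} {r : ℝ}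
    (h0 : 0 < r) (h1 : r < 1) {m : ℕ} (hm : 2 ≤ m) (G : GraphDirected X (s + t) r)
    (hB : ∀ i : Fin (s + t), s ≤ (i : ℕ) → BilipWithSymb (G.K i) m r) :
    Sys X (Fin s) (fun i => G.K (Fin.castAdd t i)) r m r where
  E i := Σ j : Fin s, Fin (G.a (Fin.castAdd t i) (Fin.castAdd t j))
  fin i := inferInstance
  t i e := e.1
  S i e := G.S _ _ e.2
  sim i e := G.sim _ _ _
  R i := ⋃ p : (Σ j : Fin t, Fin (G.a (Fin.castAdd t i) (Fin.natAdd s j))),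
    G.S _ _ p.2 '' G.K (Fin.natAdd s p.1)
  Rc i := isCompact_iUnion fun p => (G.compact _).image (sim_continuous h0.le (G.sim _ _ _))
  cover i := by
    conv_lhs => rw [G.union]
    rw [Set.iUnion_sigma, Set.iUnion_sigma]
    ext x
    simp only [Set.mem_union, Set.mem_iUnion]
    constructor
    · rintro ⟨j, e, h⟩
      induction j using Fin.addCases with
      | left j => exact Or.inr ⟨j, e, h⟩
      | right j => exact Or.inl ⟨j, e, h⟩
    · rintro (⟨j, e, h⟩ | ⟨j, e, h⟩)
      · exact ⟨_, e, h⟩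
      · exact ⟨_, e, h⟩
  disjR i e := by
    rw [Set.disjoint_iUnion_left]
    intro p
    apply G.disj
    intro h
    have h1 := congrArg (fun u => (u.1 : ℕ)) h
    simp at h1
    have := e.1.2
    omega
  disjE := by
    rintro i ⟨j, e⟩ ⟨j', e'⟩ hne
    apply G.disj
    intro h
    apply hne
    have h1 := congrArg (fun u => (u.1 : ℕ)) h
    simp only [Fin.val_castAdd] at h1
    have h2 : j = j' := Fin.ext h1
    subst h2
    simpa using h
  good i := by
    refine Good.iUnion_compact hm h0 h1 ?_
      (fun p => (G.compact _).image (sim_continuous h0.le (G.sim _ _ _))) ?_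
    · intro p
      exact Or.inr ((Par.of_bilip (hB _ (by simp))).image h0 _ h0 (G.sim _ _ _))
    · rintro ⟨j, e⟩ ⟨j', e'⟩ hne
      apply G.disj
      intro h
      apply hne
      have h1 := congrArg (fun u => (u.1 : ℕ)) h
      simp only [Fin.val_natAdd] at h1
      have h2 : j = j' := Fin.ext (by omega)
      subst h2
      simpa using h

/-- **Proposition (block upper triangular case).** Let
`K_1, …, K_s, K_{s+1}, …, K_{s+t}` be dust-like graph-directed sets with ratio
`r ∈ (0,1)` and integer characteristic `m ≥ 2` whose adjacency matrix has block
upper triangular form `[[D, C], [O, B]]` with `D` irreducible (`s × s`) and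
`C ≠ 0`. If `K_{s+1}, …, K_{s+t}` are bilipschitz equivalent to `Σ_m^r`, then so
is `K_i` for every `1 ≤ i ≤ s`. -/
theorem blockUpperTriangular_graphDirected_bilip_symb
    {X : Type*} [MetricSpace X] [CompactSpace X] {s t : ℕ} {r : ℝ}
    (hr : r ∈ Set.Ioo (0 : ℝ) 1) {m : ℕ} (hm : 2 ≤ m)
    (G : GraphDirected X (s + t) r) (hG : G.HasCharacteristic m)
    -- the adjacency matrix is block upper triangular: no edges from the second
    -- block of vertices to the first one
    (hO : ∀ i j : Fin (s + t), s ≤ (i : ℕ) → (j : ℕ) < s → G.a i j = 0)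
    -- the upper-left block `D`
    (D : Matrix (Fin s) (Fin s) ℝ)
    (hD : ∀ i j : Fin s, D i j = (G.a (Fin.castAdd t i) (Fin.castAdd t j) : ℝ))
    -- `D` is irreducible
    (hirr : ∀ i j : Fin s, ∃ k : ℕ, 0 < k ∧ 0 < (D ^ k) i j)
    -- `C ≠ 0`
    (hC : ∃ i j : Fin (s + t), (i : ℕ) < s ∧ s ≤ (j : ℕ) ∧ G.a i j ≠ 0)
    -- the sets of the second block are bilipschitz equivalent to `Σ_m^r`
    (hB : ∀ i : Fin (s + t), s ≤ (i : ℕ) → BilipWithSymb (G.K i) m r) :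
    ∀ i : Fin (s + t), (i : ℕ) < s → BilipWithSymb (G.K i) m r := by
  obtain ⟨h0, h1⟩ := hr
  obtain ⟨v, hv, hvm⟩ := hG
  intro i hi
  obtain ⟨i, rfl⟩ : ∃ i' : Fin s, Fin.castAdd t i' = i := ⟨⟨i, hi⟩, rfl⟩
  clear hi
  have : Nonempty (Fin s) := ⟨i⟩
  let A := baseSys h0 h1 hm G hB
  let v' : Fin s → ℝ := fun j => v (Fin.castAdd t j)
  have hDv : ∀ i, D.mulVec v' i +
      ∑ j : Fin t, (G.a (Fin.castAdd t i) (Fin.natAdd s j) : ℝ) * v (Fin.natAdd s j) =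
        m * v' i := by
    intro i
    rw [← hvm, Fin.sum_univ_add]
    simp only [Matrix.mulVec, dotProduct, hD, v']
  have hterm : ∀ i, ∀ j : Fin t,
      0 ≤ (G.a (Fin.castAdd t i) (Fin.natAdd s j) : ℝ) * v (Fin.natAdd s j) :=
    fun i j => mul_nonneg (Nat.cast_nonneg _) (hv _).le
  have hD0 : ∀ i j, 0 ≤ D i j := fun i j => by rw [hD]; exact Nat.cast_nonneg _
  have hle : ∀ i, D.mulVec v' i ≤ m * v' i := by
    intro i
    have := hDv i
    have := Finset.sum_nonneg (fun j (_ : j ∈ Finset.univ) => hterm i j)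
    linarith
  have hlt : ∃ i, D.mulVec v' i < m * v' i := by
    obtain ⟨i, j, hi, hj, ha⟩ := hC
    refine ⟨⟨i, hi⟩, ?_⟩
    obtain ⟨j', rfl⟩ : ∃ j' : Fin t, Fin.natAdd s j' = j :=
      ⟨⟨j - s, by have := j.2; omega⟩, Fin.ext (by simp; omega)⟩
    have h2 := hDv ⟨i, hi⟩
    have h3 : 0 < ∑ j : Fin t, (G.a (Fin.castAdd t ⟨i, hi⟩) (Fin.natAdd s j) : ℝ) *
        v (Fin.natAdd s j) := by
      refine Finset.sum_pos' (fun j _ => hterm _ j) ⟨j', Finset.mem_univ _, ?_⟩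
      exact mul_pos (by exact_mod_cast Nat.pos_of_ne_zero ha) (hv _)
    linarith
  obtain ⟨n, hn, hpow⟩ := exists_good_power hD0 hirr (m := m)
    (by exact_mod_cast (by omega : 0 < m)) (v := v') (fun i => hv _) hle hlt
  have hAD : ∀ w i, ∑ e, w (A.t i e) = (D.mulVec w) i := by
    intro w i
    change ∑ e : (Σ j : Fin s, Fin (G.a (Fin.castAdd t i) (Fin.castAdd t j))), w e.1 = _
    rw [Fintype.sum_sigma]
    simp [Matrix.mulVec, dotProduct, hD]
  have hAR : ∀ i, A.R i = ∅ → (D.mulVec v') i = m * v' i := by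
    intro i hi
    change (⋃ p : (Σ j : Fin t, Fin (G.a (Fin.castAdd t i) (Fin.natAdd s j))),
      G.S _ _ p.2 '' G.K (Fin.natAdd s p.1)) = ∅ at hi
    rw [Set.iUnion_eq_empty] at hi
    rw [← hDv i, Finset.sum_eq_zero, add_zero]
    intro j _
    have : G.a (Fin.castAdd t i) (Fin.natAdd s j) = 0 := by
      by_contra hc
      have := hi ⟨j, ⟨0, Nat.pos_of_ne_zero hc⟩⟩
      rw [Set.image_eq_empty] at this
      exact (G.nonempty _).ne_empty this
    simp [this]
  obtain ⟨B, hB1, hB2⟩ := A.exists_iter hm h0 h1 D v' hAD hAR n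
  apply Par.bilip h0
  rw [par_recode hn h0 h1]
  refine (B.recode h0 h1 hn).glue (fun i => G.compact _) ?_ (pow_pos h0 n)
    (pow_lt_one₀ h0.le h1 hn.ne') ?_ ?_ i
  · calc 2 ≤ m := hm
      _ ≤ m ^ n := Nat.le_self_pow hn.ne' m
  · intro i
    have h2 := hB1 (fun _ => 1) i
    have h3 := (hpow i).2
    rw [← h2] at h3
    change Fintype.card (B.E i) < m ^ n
    simp at h3
    exact_mod_cast h3
  · intro i hi
    exact (hpow i).1.ne (hB2 i hi)
end
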